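/- arXiv:1807.00608 — 8 statements merged into one kernel-verified Lean document; each statement's English description precedes it below -/
import Mathlib

section
/- Let 0 < α < η₂ be real numbers and set m = α/η₂. Then ∫₀^{α} ζ⁴ ((α² − ζ²)(η₂² − ζ²))^{−1/2} dζ = (η₂/3)·(2(α² + η₂²)(K(m) − E(m)) − α² K(m)). -/
open MeasureTheory intervalIntegral

/-- The complete elliptic integral of the first kind. -/
noncomputable def ellipticK (m : ℝ) : ℝ :=
  ∫ θ in (0:ℝ)..(Real.pi / 2), 1 / Real.sqrt (1 - m ^ 2 * Real.sin θ ^ 2)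

/-- The complete elliptic integral of the second kind. -/
noncomputable def ellipticE (m : ℝ) : ℝ :=
  ∫ θ in (0:ℝ)..(Real.pi / 2), Real.sqrt (1 - m ^ 2 * Real.sin θ ^ 2)

/-- The change of variables `ζ = α sin θ`. -/
lemma quartic_subst (α : ℝ) (hα : 0 < α) (g : ℝ → ℝ) :
    ∫ ζ in (0:ℝ)..α, g ζ =
      ∫ θ in (0:ℝ)..(Real.pi / 2), (α * Real.cos θ) * g (α * Real.sin θ) := by
  have hpi := Real.pi_pos
  have himg : (fun θ => α * Real.sin θ) '' Set.Ioo 0 (Real.pi / 2) = Set.Ioo 0 α := by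
    ext x
    constructor
    · rintro ⟨θ, ⟨h0, h1⟩, rfl⟩
      have hs : 0 < Real.sin θ := Real.sin_pos_of_pos_of_lt_pi h0 (by linarith)
      have hs1 : Real.sin θ < 1 := by
        have := Real.sin_lt_sin_of_lt_of_le_pi_div_two (by linarith) le_rfl h1
        rwa [Real.sin_pi_div_two] at this
      exact ⟨by positivity, by simp only; nlinarith⟩
    · rintro ⟨h0, h1⟩
      refine ⟨Real.arcsin (x / α), ⟨Real.arcsin_pos.2 (by positivity), ?_⟩, ?_⟩
      · exact Real.arcsin_lt_pi_div_two.2 ((div_lt_one hα).2 h1)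
      · have h2 : 0 < x / α := by positivity
        have h3 : x / α < 1 := (div_lt_one hα).2 h1
        simp only
        rw [Real.sin_arcsin (by linarith) h3.le]
        field_simp
  rw [integral_of_le hα.le, integral_of_le (by positivity), integral_Ioc_eq_integral_Ioo,
    integral_Ioc_eq_integral_Ioo, ← himg,
    integral_image_eq_integral_abs_deriv_smul (f' := fun θ => α * Real.cos θ) measurableSet_Ioo]
  · refine setIntegral_congr_fun measurableSet_Ioo ?_
    rintro θ ⟨h0, h1⟩
    have hc : 0 < Real.cos θ := Real.cos_pos_of_mem_Ioo ⟨by linarith, h1⟩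
    simp only [smul_eq_mul]
    rw [abs_of_pos (by positivity)]
  · intro θ _
    exact ((Real.hasDerivAt_sin θ).const_mul α).hasDerivWithinAt
  · intro a ha b hb hab
    have : Real.sin a = Real.sin b := mul_left_cancel₀ hα.ne' hab
    exact Real.injOn_sin ⟨by linarith [ha.1], ha.2.le⟩ ⟨by linarith [hb.1], hb.2.le⟩ this

/-- The Legendre reduction of the quartic moment. -/
lemma quartic_reduction (m : ℝ) (h0 : 0 < m) (h1 : m < 1) :
    3 * m ^ 4 * (∫ θ in (0:ℝ)..(Real.pi / 2),
        Real.sin θ ^ 4 / Real.sqrt (1 - m ^ 2 * Real.sin θ ^ 2)) =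
      2 * (1 + m ^ 2) * (ellipticK m - ellipticE m) - m ^ 2 * ellipticK m := by
  have hpos : ∀ θ : ℝ, 0 < 1 - m ^ 2 * Real.sin θ ^ 2 := by
    intro θ
    have := Real.sin_sq_le_one θ
    have hm : m ^ 2 < 1 := by nlinarith
    nlinarith [sq_nonneg (Real.sin θ), sq_nonneg m]
  have hsq : ∀ θ : ℝ, Real.sqrt (1 - m ^ 2 * Real.sin θ ^ 2) ≠ 0 :=
    fun θ => (Real.sqrt_pos.2 (hpos θ)).ne'
  have hcD : Continuous fun θ : ℝ => Real.sqrt (1 - m ^ 2 * Real.sin θ ^ 2) := by fun_prop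
  have hcK : Continuous fun θ : ℝ => 1 / Real.sqrt (1 - m ^ 2 * Real.sin θ ^ 2) :=
    continuous_const.div hcD hsq
  have hc4 : Continuous fun θ : ℝ => Real.sin θ ^ 4 / Real.sqrt (1 - m ^ 2 * Real.sin θ ^ 2) :=
    (by fun_prop : Continuous fun θ : ℝ => Real.sin θ ^ 4).div hcD hsq
  have hderiv : ∀ θ : ℝ, HasDerivAt
      (fun θ => m ^ 2 * (Real.sin θ * Real.cos θ * Real.sqrt (1 - m ^ 2 * Real.sin θ ^ 2)))
      (3 * m ^ 4 * (Real.sin θ ^ 4 / Real.sqrt (1 - m ^ 2 * Real.sin θ ^ 2))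
        - (2 + m ^ 2) * (1 / Real.sqrt (1 - m ^ 2 * Real.sin θ ^ 2))
        + 2 * (1 + m ^ 2) * Real.sqrt (1 - m ^ 2 * Real.sin θ ^ 2)) θ := by
    intro θ
    have hs := Real.hasDerivAt_sin θ
    have hc := Real.hasDerivAt_cos θ
    have hD := (((hs.pow 2).const_mul (m ^ 2)).const_sub 1).sqrt (hpos θ).ne'
    have := (((hs.mul hc).mul hD).const_mul (m ^ 2))
    refine this.congr_deriv ?_
    simp only [Pi.pow_apply, Pi.mul_apply]
    have hne := hsq θ
    have hss := Real.sq_sqrt (hpos θ).le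
    have hcc := Real.cos_sq' θ
    set D := Real.sqrt (1 - m ^ 2 * Real.sin θ ^ 2)
    field_simp
    simp only [hss, hcc]
    ring_nf
    try simp only [hss, hcc]
    try ring_nf
  have hF := integral_eq_sub_of_hasDerivAt (a := 0) (b := Real.pi / 2) (fun θ _ => hderiv θ)
    (Continuous.intervalIntegrable (by fun_prop) _ _)
  rw [intervalIntegral.integral_add (Continuous.intervalIntegrable (by fun_prop) _ _)
      (Continuous.intervalIntegrable (by fun_prop) _ _),
    intervalIntegral.integral_sub (Continuous.intervalIntegrable (by fun_prop) _ _)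
      (Continuous.intervalIntegrable (by fun_prop) _ _),
    intervalIntegral.integral_const_mul, intervalIntegral.integral_const_mul,
    intervalIntegral.integral_const_mul] at hF
  simp only [Real.cos_pi_div_two, Real.sin_zero, mul_zero, zero_mul, sub_zero] at hF
  unfold ellipticK ellipticE
  linarith

/-- ∫₀^{α} ζ⁴ ((α² − ζ²)(η₂² − ζ²))^{−1/2} dζ
    = (η₂/3)(2(α² + η₂²)(K(m) − E(m)) − α²K(m)), m = α/η₂. -/
theorem integral_quartic_inv_sqrt_eq (α η₂ : ℝ) (hα : 0 < α) (hη : α < η₂) :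
    ∫ ζ in (0:ℝ)..α, ζ ^ 4 / Real.sqrt ((α ^ 2 - ζ ^ 2) * (η₂ ^ 2 - ζ ^ 2)) =
      (η₂ / 3) * (2 * (α ^ 2 + η₂ ^ 2) * (ellipticK (α / η₂) - ellipticE (α / η₂)) -
        α ^ 2 * ellipticK (α / η₂)) := by
  have hη0 : 0 < η₂ := hα.trans hη
  have hred := quartic_reduction (α / η₂) (by positivity) ((div_lt_one hη0).2 hη)
  rw [quartic_subst α hα]
  have hcongr : ∫ θ in (0:ℝ)..(Real.pi / 2), (α * Real.cos θ) *
        ((α * Real.sin θ) ^ 4 / Real.sqrt ((α ^ 2 - (α * Real.sin θ) ^ 2) *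
          (η₂ ^ 2 - (α * Real.sin θ) ^ 2))) =
      ∫ θ in (0:ℝ)..(Real.pi / 2), α ^ 4 / η₂ *
        (Real.sin θ ^ 4 / Real.sqrt (1 - (α / η₂) ^ 2 * Real.sin θ ^ 2)) := by
    have hpi := Real.pi_pos
    rw [integral_of_le (by positivity), integral_of_le (by positivity),
      integral_Ioc_eq_integral_Ioo, integral_Ioc_eq_integral_Ioo]
    refine setIntegral_congr_fun measurableSet_Ioo ?_
    rintro θ ⟨h0, h1⟩
    have hc : 0 < Real.cos θ := Real.cos_pos_of_mem_Ioo ⟨by linarith, h1⟩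
    have e : (α ^ 2 - (α * Real.sin θ) ^ 2) * (η₂ ^ 2 - (α * Real.sin θ) ^ 2) =
        (α * Real.cos θ * η₂) ^ 2 * (1 - (α / η₂) ^ 2 * Real.sin θ ^ 2) := by
      rw [mul_pow, mul_pow, mul_pow, Real.cos_sq']
      field_simp
    simp only
    rw [e, Real.sqrt_mul (sq_nonneg _), Real.sqrt_sq (by positivity)]
    have hD : 0 < 1 - (α / η₂) ^ 2 * Real.sin θ ^ 2 := by
      have h2 := Real.sin_sq_le_one θ
      have h3 : α / η₂ < 1 := (div_lt_one hη0).2 hη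
      have h4 : 0 < α / η₂ := by positivity
      have h5 : (α / η₂) ^ 2 < 1 := by nlinarith
      nlinarith [sq_nonneg (Real.sin θ), sq_nonneg (α / η₂)]
    have hne := (Real.sqrt_pos.2 hD).ne'
    set D := Real.sqrt (1 - (α / η₂) ^ 2 * Real.sin θ ^ 2)
    field_simp
  rw [hcongr, intervalIntegral.integral_const_mul]
  set S := ∫ θ in (0:ℝ)..(Real.pi / 2),
    Real.sin θ ^ 4 / Real.sqrt (1 - (α / η₂) ^ 2 * Real.sin θ ^ 2)
  set K := ellipticK (α / η₂)
  set E := ellipticE (α / η₂)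
  have e1 : α ^ 4 / η₂ * S = η₂ ^ 3 / 3 * (3 * (α / η₂) ^ 4 * S) := by field_simp
  rw [e1, hred]
  field_simp
  try ring
end

section
/- Let 0 < α < η₂ be real numbers and set m = α/η₂. Then ∫_{α}^{η₂} (ζ² − η₂²(1 − E(m)/K(m))) · ((ζ² − α²)(η₂² − ζ²))^{−1/2} dζ = π η₂ / (2 K(m)). -/
open MeasureTheory intervalIntegral

namespace LegendreAux

noncomputable def kk (p : ℝ) : ℝ :=
  ∫ θ in (0:ℝ)..(Real.pi / 2), 1 / Real.sqrt (1 - p * Real.sin θ ^ 2)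

noncomputable def ee (p : ℝ) : ℝ :=
  ∫ θ in (0:ℝ)..(Real.pi / 2), Real.sqrt (1 - p * Real.sin θ ^ 2)

noncomputable def jj (p : ℝ) : ℝ :=
  ∫ θ in (0:ℝ)..(Real.pi / 2), Real.sin θ ^ 2 / Real.sqrt (1 - p * Real.sin θ ^ 2) ^ 3

lemma lower {p r : ℝ} (hp : p ≤ r) (hr0 : 0 ≤ r) (θ : ℝ) :
    1 - r ≤ 1 - p * Real.sin θ ^ 2 := by
  have h1 := Real.sin_sq_le_one θ
  have h0 := sq_nonneg (Real.sin θ)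
  nlinarith

lemma dpos {p : ℝ} (hp : p < 1) (θ : ℝ) : 0 < 1 - p * Real.sin θ ^ 2 := by
  have h1 := Real.sin_sq_le_one θ
  have h0 := sq_nonneg (Real.sin θ)
  rcases le_total p 0 with h | h <;> nlinarith

lemma sne {p : ℝ} (hp : p < 1) (θ : ℝ) : Real.sqrt (1 - p * Real.sin θ ^ 2) ≠ 0 :=
  (Real.sqrt_pos.2 (dpos hp θ)).ne'

lemma contS (p : ℝ) : Continuous fun θ : ℝ => Real.sqrt (1 - p * Real.sin θ ^ 2) := by
  fun_prop

lemma contI {p : ℝ} (hp : p < 1) :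
    Continuous fun θ : ℝ => 1 / Real.sqrt (1 - p * Real.sin θ ^ 2) :=
  continuous_const.div (contS p) (sne hp)

lemma contJ {p : ℝ} (hp : p < 1) :
    Continuous fun θ : ℝ => Real.sin θ ^ 2 / Real.sqrt (1 - p * Real.sin θ ^ 2) ^ 3 :=
  (by fun_prop : Continuous fun θ : ℝ => Real.sin θ ^ 2).div ((contS p).pow 3)
    (fun θ => pow_ne_zero 3 (sne hp θ))

lemma derS {p : ℝ} (hp : p < 1) (θ : ℝ) :
    HasDerivAt (fun x => Real.sqrt (1 - x * Real.sin θ ^ 2))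
      (-(Real.sin θ ^ 2) / (2 * Real.sqrt (1 - p * Real.sin θ ^ 2))) p := by
  have h : HasDerivAt (fun x : ℝ => 1 - x * Real.sin θ ^ 2) (-(Real.sin θ ^ 2)) p := by
    simpa using ((hasDerivAt_id p).mul_const (Real.sin θ ^ 2)).const_sub 1
  exact h.sqrt (dpos hp θ).ne'

lemma derI {p : ℝ} (hp : p < 1) (θ : ℝ) :
    HasDerivAt (fun x => 1 / Real.sqrt (1 - x * Real.sin θ ^ 2))
      (Real.sin θ ^ 2 / Real.sqrt (1 - p * Real.sin θ ^ 2) ^ 3 / 2) p := by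
  have h := (derS hp θ).inv (sne hp θ)
  have hs := sne hp θ
  try simp only [one_div]
  refine HasDerivAt.congr_deriv h ?_
  field_simp

lemma hasDerivAt_kk {p : ℝ} (h0 : 0 < p) (h1 : p < 1) : HasDerivAt kk (jj p / 2) p := by
  set r : ℝ := (1 + p) / 2 with hr
  have hr1 : r < 1 := by linarith
  have hpr : p < r := by linarith
  have hs : Set.Ioo 0 r ∈ nhds p := Ioo_mem_nhds h0 hpr
  have key := (intervalIntegral.hasDerivAt_integral_of_dominated_loc_of_deriv_le
    (μ := volume) (a := 0) (b := Real.pi / 2)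
    (F := fun (x θ : ℝ) => 1 / Real.sqrt (1 - x * Real.sin θ ^ 2))
    (F' := fun (x θ : ℝ) => Real.sin θ ^ 2 / Real.sqrt (1 - x * Real.sin θ ^ 2) ^ 3 / 2)
    (x₀ := p) (s := Set.Ioo 0 r) (bound := fun _ => 1 / Real.sqrt (1 - r) ^ 3 / 2)
    hs ?_ ((contI h1).intervalIntegrable _ _) ?_ ?_ ?_ ?_).2
  · have : jj p / 2 = ∫ θ in (0:ℝ)..(Real.pi / 2),
        Real.sin θ ^ 2 / Real.sqrt (1 - p * Real.sin θ ^ 2) ^ 3 / 2 := by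
      rw [intervalIntegral.integral_div]; rfl
    rw [this]; exact key
  · filter_upwards [hs] with x hx
    exact (contI (hx.2.trans hr1)).aestronglyMeasurable
  · exact ((contJ h1).div_const 2).aestronglyMeasurable
  · refine Filter.Eventually.of_forall fun θ _ x hx => ?_
    have hx1 := hx.2.trans hr1
    have hp := Real.sqrt_pos.2 (dpos hx1 θ)
    have hq : 0 < Real.sqrt (1 - r) := Real.sqrt_pos.2 (by linarith)
    have hle := Real.sqrt_le_sqrt (lower hx.2.le (h0.trans hpr).le θ)
    rw [Real.norm_of_nonneg (by positivity)]
    have := Real.sin_sq_le_one θ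
    gcongr
  · exact intervalIntegrable_const
  · exact Filter.Eventually.of_forall fun θ _ x hx => derI (hx.2.trans hr1) θ

lemma hasDerivAt_ee {p : ℝ} (h0 : 0 < p) (h1 : p < 1) :
    HasDerivAt ee ((ee p - kk p) / (2 * p)) p := by
  set r : ℝ := (1 + p) / 2 with hr
  have hr1 : r < 1 := by linarith
  have hpr : p < r := by linarith
  have hs : Set.Ioo 0 r ∈ nhds p := Ioo_mem_nhds h0 hpr
  have key := (intervalIntegral.hasDerivAt_integral_of_dominated_loc_of_deriv_le
    (μ := volume) (a := 0) (b := Real.pi / 2)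
    (F := fun (x θ : ℝ) => Real.sqrt (1 - x * Real.sin θ ^ 2))
    (F' := fun (x θ : ℝ) => -(Real.sin θ ^ 2) / (2 * Real.sqrt (1 - x * Real.sin θ ^ 2)))
    (x₀ := p) (s := Set.Ioo 0 r) (bound := fun _ => 1 / (2 * Real.sqrt (1 - r)))
    hs ?_ ((contS p).intervalIntegrable _ _) ?_ ?_ ?_ ?_).2
  · have : (ee p - kk p) / (2 * p) = ∫ θ in (0:ℝ)..(Real.pi / 2),
        -(Real.sin θ ^ 2) / (2 * Real.sqrt (1 - p * Real.sin θ ^ 2)) := by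
      unfold ee kk
      rw [← intervalIntegral.integral_sub ((contS p).intervalIntegrable _ _)
        ((contI h1).intervalIntegrable _ _), ← intervalIntegral.integral_div]
      refine intervalIntegral.integral_congr fun θ _ => ?_
      have hs := sne h1 θ
      have hq := Real.sq_sqrt (dpos h1 θ).le
      try simp only
      field_simp
      rw [hq]; ring
    rw [this]; exact key
  · filter_upwards [hs] with x hx
    exact (contS x).aestronglyMeasurable
  · refine Continuous.aestronglyMeasurable ?_
    exact (by fun_prop : Continuous fun θ : ℝ => -(Real.sin θ ^ 2)).div
      (continuous_const.mul (contS p)) (fun θ => mul_ne_zero two_ne_zero (sne h1 θ))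
  · refine Filter.Eventually.of_forall fun θ _ x hx => ?_
    have hx1 := hx.2.trans hr1
    have hp := Real.sqrt_pos.2 (dpos hx1 θ)
    have hq : 0 < Real.sqrt (1 - r) := Real.sqrt_pos.2 (by linarith)
    have hle := Real.sqrt_le_sqrt (lower hx.2.le (h0.trans hpr).le θ)
    rw [neg_div, norm_neg, Real.norm_of_nonneg (by positivity)]
    have := Real.sin_sq_le_one θ
    gcongr
  · exact intervalIntegrable_const
  · exact Filter.Eventually.of_forall fun θ _ x hx => derS (hx.2.trans hr1) θ

lemma jj_eq {p : ℝ} (h1 : p < 1) : ee p - (1 - p) * kk p = p * (1 - p) * jj p := by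
  have hd : ∀ θ : ℝ, HasDerivAt
      (fun θ => Real.sin θ * Real.cos θ / Real.sqrt (1 - p * Real.sin θ ^ 2))
      ((1 - 2 * Real.sin θ ^ 2 + p * Real.sin θ ^ 4) / Real.sqrt (1 - p * Real.sin θ ^ 2) ^ 3) θ := by
    intro θ
    have hu : HasDerivAt (fun θ : ℝ => 1 - p * Real.sin θ ^ 2)
        (-(p * (2 * Real.sin θ * Real.cos θ))) θ := by
      have := (((Real.hasDerivAt_sin θ).pow 2).const_mul p).const_sub 1
      simpa using this
    have := ((Real.hasDerivAt_sin θ).mul (Real.hasDerivAt_cos θ)).div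
      (hu.sqrt (dpos h1 θ).ne') (sne h1 θ)
    refine HasDerivAt.congr_deriv this ?_
    have hs := sne h1 θ
    have hq := Real.sq_sqrt (dpos h1 θ).le
    have hc := Real.cos_sq' θ
    simp only [Pi.mul_apply]
    generalize Real.sqrt (1 - p * Real.sin θ ^ 2) = w at hs hq ⊢
    field_simp
    rw [hq, hc]; ring
  have hcont : Continuous fun θ : ℝ =>
      (1 - 2 * Real.sin θ ^ 2 + p * Real.sin θ ^ 4) / Real.sqrt (1 - p * Real.sin θ ^ 2) ^ 3 :=
    (by fun_prop : Continuous fun θ : ℝ => 1 - 2 * Real.sin θ ^ 2 + p * Real.sin θ ^ 4).div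
      ((contS p).pow 3) (fun θ => pow_ne_zero 3 (sne h1 θ))
  have hz := intervalIntegral.integral_eq_sub_of_hasDerivAt (a := 0) (b := Real.pi / 2)
    (fun θ _ => hd θ) (hcont.intervalIntegrable _ _)
  simp at hz
  have : ee p - (1 - p) * kk p - p * (1 - p) * jj p = p * ∫ θ in (0:ℝ)..(Real.pi / 2),
      (1 - 2 * Real.sin θ ^ 2 + p * Real.sin θ ^ 4) / Real.sqrt (1 - p * Real.sin θ ^ 2) ^ 3 := by
    have i1 : IntervalIntegrable (fun θ : ℝ => Real.sqrt (1 - p * Real.sin θ ^ 2))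
        volume 0 (Real.pi / 2) := (contS p).intervalIntegrable _ _
    have i2 : IntervalIntegrable (fun θ : ℝ => (1 - p) * (1 / Real.sqrt (1 - p * Real.sin θ ^ 2)))
        volume 0 (Real.pi / 2) := ((contI h1).intervalIntegrable _ _).const_mul _
    have i3 : IntervalIntegrable (fun θ : ℝ => p * (1 - p) *
        (Real.sin θ ^ 2 / Real.sqrt (1 - p * Real.sin θ ^ 2) ^ 3))
        volume 0 (Real.pi / 2) := ((contJ h1).intervalIntegrable _ _).const_mul _
    unfold ee kk jj
    rw [← intervalIntegral.integral_const_mul, ← intervalIntegral.integral_const_mul,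
      ← intervalIntegral.integral_const_mul,
      ← intervalIntegral.integral_sub i1 i2, ← intervalIntegral.integral_sub (i1.sub i2) i3]
    refine intervalIntegral.integral_congr fun θ _ => ?_
    have hs := sne h1 θ
    have hq := Real.sq_sqrt (dpos h1 θ).le
    try simp only
    field_simp
    rw [hq]; ring
  rw [hz, mul_zero] at this
  linarith

noncomputable def LL (p : ℝ) : ℝ := ee p * kk (1 - p) + ee (1 - p) * kk p - kk p * kk (1 - p)

lemma hasDerivAt_LL {p : ℝ} (h0 : 0 < p) (h1 : p < 1) : HasDerivAt LL 0 p := by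
  have hq0 : 0 < 1 - p := by linarith
  have hq1 : 1 - p < 1 := by linarith
  have a := hasDerivAt_kk h0 h1
  have b := hasDerivAt_ee h0 h1
  have hsub : HasDerivAt (fun x : ℝ => 1 - x) (-1) p := by
    simpa using (hasDerivAt_id p).const_sub 1
  have c := (hasDerivAt_kk hq0 hq1).comp p hsub
  have d := (hasDerivAt_ee hq0 hq1).comp p hsub
  have := ((b.mul c).add (d.mul a)).sub (a.mul c)
  have j1 := jj_eq h1
  have j2 := jj_eq hq1
  have j1' : jj p = (ee p - (1 - p) * kk p) / (p * (1 - p)) := by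
    rw [j1]; field_simp
  have j2' : jj (1 - p) = (ee (1 - p) - p * kk (1 - p)) / (p * (1 - p)) := by
    rw [eq_div_iff (by positivity)]; linarith
  refine HasDerivAt.congr_deriv this ?_
  try simp only [Function.comp]
  rw [j1', j2']
  field_simp
  ring

lemma ee_one : ee 1 = 1 := by
  have : ee 1 = ∫ θ in (0:ℝ)..(Real.pi / 2), Real.cos θ := by
    refine intervalIntegral.integral_congr fun θ hθ => ?_
    rw [Set.uIcc_of_le (by positivity)] at hθ
    have hc : 0 ≤ Real.cos θ := Real.cos_nonneg_of_mem_Icc ⟨by linarith [hθ.1, Real.pi_pos], hθ.2⟩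
    try simp only
    rw [one_mul, ← Real.cos_sq', Real.sqrt_sq hc]
  rw [this]; simp

lemma cont_ee : Continuous ee := by
  unfold ee
  apply intervalIntegral.continuous_parametric_intervalIntegral_of_continuous'
  fun_prop

lemma kk_bound {p : ℝ} (h0 : 0 < p) (h1 : p < 1) :
    0 ≤ kk p ∧ kk p ≤ (Real.pi / 2) / Real.sqrt (1 - p) := by
  constructor
  · exact intervalIntegral.integral_nonneg (by positivity) fun θ _ => by positivity
  · have : (Real.pi / 2) / Real.sqrt (1 - p) =
      ∫ θ in (0:ℝ)..(Real.pi / 2), 1 / Real.sqrt (1 - p) := by simp; ring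
    rw [this]
    refine intervalIntegral.integral_mono_on (by positivity) ((contI h1).intervalIntegrable _ _)
      intervalIntegrable_const fun θ _ => ?_
    have hq : 0 < Real.sqrt (1 - p) := Real.sqrt_pos.2 (by linarith)
    have := Real.sqrt_le_sqrt (lower le_rfl h0.le θ)
    gcongr

lemma kk_pos {p : ℝ} (h1 : p < 1) : 0 < kk p := by
  refine intervalIntegral.intervalIntegral_pos_of_pos_on ((contI h1).intervalIntegrable _ _)
    (fun θ _ => ?_) (by positivity)
  have := Real.sqrt_pos.2 (dpos h1 θ)
  positivity

lemma diff_bound {p : ℝ} (h0 : 0 < p) (h1 : p < 1) : |ee p - kk p| ≤ p * kk p := by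
  have hk : IntervalIntegrable (fun θ : ℝ => 1 / Real.sqrt (1 - p * Real.sin θ ^ 2))
    volume 0 (Real.pi / 2) := (contI h1).intervalIntegrable _ _
  have he : IntervalIntegrable (fun θ : ℝ => Real.sqrt (1 - p * Real.sin θ ^ 2))
    volume 0 (Real.pi / 2) := (contS p).intervalIntegrable _ _
  have e1 : ee p ≤ kk p := by
    refine intervalIntegral.integral_mono_on (by positivity) he hk fun θ _ => ?_
    have hs := Real.sqrt_pos.2 (dpos h1 θ)
    rw [le_div_iff₀ hs, Real.mul_self_sqrt (dpos h1 θ).le]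
    nlinarith [sq_nonneg (Real.sin θ)]
  have e2 : (1 - p) * kk p ≤ ee p := by
    unfold kk ee
    rw [← intervalIntegral.integral_const_mul]
    refine intervalIntegral.integral_mono_on (by positivity) (hk.const_mul _) he fun θ _ => ?_
    have hs := Real.sqrt_pos.2 (dpos h1 θ)
    rw [mul_one_div, div_le_iff₀ hs, Real.mul_self_sqrt (dpos h1 θ).le]
    exact lower le_rfl h0.le θ
  rw [abs_le]; constructor <;> nlinarith

lemma kk_tendsto : Filter.Tendsto kk (nhdsWithin 0 (Set.Ioi 0)) (nhds (Real.pi / 2)) := by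
  have hu : Filter.Tendsto (fun p : ℝ => (Real.pi / 2) / Real.sqrt (1 - p))
      (nhdsWithin 0 (Set.Ioi 0)) (nhds (Real.pi / 2)) := by
    have : ContinuousAt (fun p : ℝ => (Real.pi / 2) / Real.sqrt (1 - p)) 0 := by
      refine ContinuousAt.div (by fun_prop) (by fun_prop) (by simp)
    have := this.tendsto
    simp only [sub_zero, Real.sqrt_one, div_one] at this
    exact this.mono_left nhdsWithin_le_nhds
  have hI : Set.Ioo (0:ℝ) 1 ∈ nhdsWithin (0:ℝ) (Set.Ioi 0) := Ioo_mem_nhdsGT one_pos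
  refine tendsto_of_tendsto_of_tendsto_of_le_of_le' tendsto_const_nhds hu ?_ ?_
  · filter_upwards [hI] with p hp
    have : Real.pi / 2 = ∫ θ in (0:ℝ)..(Real.pi / 2), (1:ℝ) := by simp
    rw [this]
    unfold kk
    refine intervalIntegral.integral_mono_on (by positivity) intervalIntegrable_const
      ((contI hp.2).intervalIntegrable _ _) fun θ _ => ?_
    have hs := Real.sqrt_pos.2 (dpos hp.2 θ)
    rw [le_div_iff₀ hs, one_mul]
    exact Real.sqrt_le_one.2 (by nlinarith [sq_nonneg (Real.sin θ), hp.1])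
  · filter_upwards [hI] with p hp
    exact (kk_bound hp.1 hp.2).2

lemma LL_tendsto : Filter.Tendsto LL (nhdsWithin 0 (Set.Ioi 0)) (nhds (Real.pi / 2)) := by
  have hI : Set.Ioo (0:ℝ) 1 ∈ nhdsWithin (0:ℝ) (Set.Ioi 0) := Ioo_mem_nhdsGT one_pos
  have hE : Filter.Tendsto (fun p => ee (1 - p)) (nhdsWithin 0 (Set.Ioi 0)) (nhds 1) := by
    have : Continuous fun p : ℝ => ee (1 - p) := cont_ee.comp (by fun_prop)
    have := this.tendsto 0
    rw [sub_zero, ee_one] at this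
    exact this.mono_left nhdsWithin_le_nhds
  have hs : Filter.Tendsto (fun p : ℝ => Real.sqrt p) (nhdsWithin 0 (Set.Ioi 0)) (nhds 0) := by
    have := Real.continuous_sqrt.tendsto 0
    rw [Real.sqrt_zero] at this
    exact this.mono_left nhdsWithin_le_nhds
  have hD : Filter.Tendsto (fun p => (ee p - kk p) * kk (1 - p))
      (nhdsWithin 0 (Set.Ioi 0)) (nhds 0) := by
    have hb : Filter.Tendsto (fun p : ℝ => Real.sqrt p * (kk p * (Real.pi / 2)))
        (nhdsWithin 0 (Set.Ioi 0)) (nhds 0) := by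
      simpa using hs.mul (kk_tendsto.mul_const (Real.pi / 2))
    refine squeeze_zero_norm' ?_ hb
    filter_upwards [hI] with p hp
    have h0 := hp.1
    have k1 := (kk_bound hp.1 hp.2).1
    have k2 := kk_bound (p := 1 - p) (by linarith [hp.2]) (by linarith [hp.1])
    rw [sub_sub_cancel] at k2
    have hsp := Real.sqrt_pos.2 hp.1
    have hsq := Real.mul_self_sqrt hp.1.le
    rw [norm_mul, Real.norm_eq_abs, Real.norm_of_nonneg k2.1]
    calc |ee p - kk p| * kk (1 - p) ≤ (p * kk p) * ((Real.pi / 2) / Real.sqrt p) :=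
          mul_le_mul (diff_bound hp.1 hp.2) k2.2 k2.1 (by positivity)
      _ = (Real.sqrt p * Real.sqrt p * kk p) * ((Real.pi / 2) / Real.sqrt p) := by rw [hsq]
      _ = _ := by field_simp
  have := hD.add (hE.mul kk_tendsto)
  rw [zero_add, one_mul] at this
  refine this.congr fun p => ?_
  unfold LL; ring

lemma legendre {p : ℝ} (h0 : 0 < p) (h1 : p < 1) : LL p = Real.pi / 2 := by
  have hI : Set.Ioo (0:ℝ) 1 ∈ nhdsWithin (0:ℝ) (Set.Ioi 0) := Ioo_mem_nhdsGT one_pos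
  have hc : ∀ x ∈ Set.Ioo (0:ℝ) 1, LL x = LL p := fun x hx =>
    isOpen_Ioo.is_const_of_deriv_eq_zero isPreconnected_Ioo
      (fun y hy => (hasDerivAt_LL hy.1 hy.2).differentiableAt.differentiableWithinAt)
      (fun y hy => (hasDerivAt_LL hy.1 hy.2).deriv) hx ⟨h0, h1⟩
  refine tendsto_nhds_unique (Filter.Tendsto.congr' ?_ tendsto_const_nhds) LL_tendsto
  filter_upwards [hI] with x hx
  exact (hc x hx).symm

lemma subst_int (α η c : ℝ) (hα : 0 < α) (hη : α < η) :
    ∫ ζ in α..η, (ζ ^ 2 - c) / Real.sqrt ((ζ ^ 2 - α ^ 2) * (η ^ 2 - ζ ^ 2)) =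
      η * ee (1 - (α / η) ^ 2) - c / η * kk (1 - (α / η) ^ 2) := by
  have hη0 : 0 < η := hα.trans hη
  set q : ℝ := 1 - (α / η) ^ 2 with hq
  have hm0 : 0 < α / η := by positivity
  have hm1 : α / η < 1 := (div_lt_one hη0).2 hη
  have hq1 : q < 1 := by rw [hq]; nlinarith
  have hq0 : 0 < q := by rw [hq]; nlinarith
  have hαq : α ^ 2 = η ^ 2 * (1 - q) := by rw [hq]; field_simp; ring
  set f : ℝ → ℝ := fun θ => η * Real.sqrt (1 - q * Real.sin θ ^ 2) with hf
  set f' : ℝ → ℝ := fun θ =>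
    -(η * q * Real.sin θ * Real.cos θ / Real.sqrt (1 - q * Real.sin θ ^ 2)) with hf'
  have hfd : ∀ θ, HasDerivAt f (f' θ) θ := by
    intro θ
    have hu : HasDerivAt (fun θ : ℝ => 1 - q * Real.sin θ ^ 2)
        (-(q * (2 * Real.sin θ * Real.cos θ))) θ := by
      have := (((Real.hasDerivAt_sin θ).pow 2).const_mul q).const_sub 1
      simpa using this
    have := (hu.sqrt (dpos hq1 θ).ne').const_mul η
    refine HasDerivAt.congr_deriv this ?_
    have hs := sne hq1 θ
    try simp only [hf']
    field_simp
  have hsc : ∀ θ ∈ Set.Ioo (0:ℝ) (Real.pi / 2), 0 < Real.sin θ ∧ 0 < Real.cos θ := fun θ hθ =>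
    ⟨Real.sin_pos_of_pos_of_lt_pi hθ.1 (by linarith [hθ.2, Real.pi_pos]),
      Real.cos_pos_of_mem_Ioo ⟨by linarith [hθ.1, Real.pi_pos], hθ.2⟩⟩
  have hfc : Continuous f := by rw [hf]; fun_prop
  have hanti : StrictAntiOn f (Set.Icc 0 (Real.pi / 2)) := by
    refine strictAntiOn_of_deriv_neg (convex_Icc _ _) hfc.continuousOn fun θ hθ => ?_
    rw [interior_Icc] at hθ
    obtain ⟨h1, h2⟩ := hsc θ hθ
    have := Real.sqrt_pos.2 (dpos hq1 θ)
    rw [(hfd θ).deriv]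
    try simp only [hf', Left.neg_neg_iff]
    positivity
  have f0 : f 0 = η := by simp [hf]
  have f1 : f (Real.pi / 2) = α := by
    try simp only [hf, Real.sin_pi_div_two]
    have : 1 - q * 1 ^ 2 = (α / η) ^ 2 := by rw [hq]; ring
    rw [this, Real.sqrt_sq hm0.le]; field_simp
  have himg : f '' Set.Ioo 0 (Real.pi / 2) = Set.Ioo α η := by
    apply Set.Subset.antisymm
    · rintro _ ⟨θ, hθ, rfl⟩
      constructor
      · rw [← f1]
        exact hanti ⟨hθ.1.le, hθ.2.le⟩ ⟨by positivity, le_rfl⟩ hθ.2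
      · rw [← f0]
        exact hanti ⟨le_rfl, by positivity⟩ ⟨hθ.1.le, hθ.2.le⟩ hθ.1
    · have := intermediate_value_Ioo' (by positivity : (0:ℝ) ≤ Real.pi / 2) hfc.continuousOn
      rwa [f0, f1] at this
  rw [intervalIntegral.integral_of_le hη.le, integral_Ioc_eq_integral_Ioo, ← himg,
    integral_image_eq_integral_abs_deriv_smul measurableSet_Ioo
      (fun θ _ => (hfd θ).hasDerivWithinAt) (hanti.injOn.mono Set.Ioo_subset_Icc_self)]
  unfold ee kk
  rw [← intervalIntegral.integral_const_mul, ← intervalIntegral.integral_const_mul,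
    ← intervalIntegral.integral_sub (((contS q).intervalIntegrable _ _).const_mul _)
      (((contI hq1).intervalIntegrable _ _).const_mul _),
    intervalIntegral.integral_of_le (by positivity), integral_Ioc_eq_integral_Ioo]
  refine setIntegral_congr_fun measurableSet_Ioo fun θ hθ => ?_
  obtain ⟨h1, h2⟩ := hsc θ hθ
  have hs := Real.sqrt_pos.2 (dpos hq1 θ)
  have hsq := Real.sq_sqrt (dpos hq1 θ).le
  have hcos := Real.sin_sq θ
  have hf2 : f θ ^ 2 = η ^ 2 * (1 - q * Real.sin θ ^ 2) := by
    try simp only [hf]; rw [mul_pow, hsq]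
  have hroot : Real.sqrt ((f θ ^ 2 - α ^ 2) * (η ^ 2 - f θ ^ 2)) =
      η ^ 2 * q * Real.sin θ * Real.cos θ := by
    have : (f θ ^ 2 - α ^ 2) * (η ^ 2 - f θ ^ 2) = (η ^ 2 * q * Real.sin θ * Real.cos θ) ^ 2 := by
      rw [hf2, hαq, mul_pow _ (Real.cos θ), Real.cos_sq']; ring
    rw [this, Real.sqrt_sq (by positivity)]
  have habs : |f' θ| = η * q * Real.sin θ * Real.cos θ / Real.sqrt (1 - q * Real.sin θ ^ 2) := by
    try simp only [hf']; rw [abs_neg, abs_of_nonneg (by positivity)]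
  try simp only [smul_eq_mul]
  rw [hroot, habs, hf2, ← hsq]
  rw [Real.sqrt_sq hs.le]
  field_simp

end LegendreAux

/-- ∫_α^{η₂} (ζ² − η₂²(1 − E(m)/K(m)))((ζ² − α²)(η₂² − ζ²))^{−1/2} dζ
    = πη₂/(2K(m)), m = α/η₂. -/
theorem integral_Q1_eq_legendre (α η₂ : ℝ) (hα : 0 < α) (hη : α < η₂) :
    ∫ ζ in α..η₂,
      (ζ ^ 2 - η₂ ^ 2 * (1 - ellipticE (α / η₂) / ellipticK (α / η₂))) /
        Real.sqrt ((ζ ^ 2 - α ^ 2) * (η₂ ^ 2 - ζ ^ 2)) =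
      Real.pi * η₂ / (2 * ellipticK (α / η₂)) := by
  have hη0 : 0 < η₂ := hα.trans hη
  have hm0 : 0 < α / η₂ := by positivity
  have hm1 : α / η₂ < 1 := (div_lt_one hη0).2 hη
  rw [LegendreAux.subst_int α η₂ _ hα hη]
  have hp0 : 0 < (α / η₂) ^ 2 := by positivity
  have hp1 : (α / η₂) ^ 2 < 1 := by nlinarith
  have hL := LegendreAux.legendre hp0 hp1
  have hk := LegendreAux.kk_pos hp1
  have e1 : ellipticE (α / η₂) = LegendreAux.ee ((α / η₂) ^ 2) := rfl
  have e2 : ellipticK (α / η₂) = LegendreAux.kk ((α / η₂) ^ 2) := rfl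
  rw [e1, e2]
  unfold LegendreAux.LL at hL
  generalize LegendreAux.kk ((α / η₂) ^ 2) = k at *
  generalize LegendreAux.ee ((α / η₂) ^ 2) = e at *
  generalize LegendreAux.kk (1 - (α / η₂) ^ 2) = k' at *
  generalize LegendreAux.ee (1 - (α / η₂) ^ 2) = e' at *
  have hpi : Real.pi = 2 * (e * k' + e' * k - k * k') := by linarith
  rw [hpi]
  field_simp
  ring
end

section
/- Let 0 < α < η₂ and ξ be real numbers, set ρ = (η₂² − α²)/2 + ξ/3 and define h(ζ) = √(α² − ζ²)/√(η₂² − ζ²) · (ζ² − ρ) for ζ ∈ [0, α]. If ∫₀^{α} h(ζ) dζ = 0, then for every λ ∈ (0, α) one has ∫_{λ}^{α} h(ζ) dζ > 0. -/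
open MeasureTheory intervalIntegral

/-- with h(ζ) = √(α² − ζ²)/√(η₂² − ζ²)·(ζ² − ρ),
ρ = (η₂² − α²)/2 + ξ/3, the vanishing of ∫₀^α h implies that all tail
integrals ∫_λ^α h with λ ∈ (0, α) are strictly positive. -/
theorem tail_integral_pos_g_signs
    (α η₂ ξ : ℝ) (hα : 0 < α) (hη : α < η₂)
    (h : ℝ → ℝ)
    (hdef : ∀ ζ : ℝ, h ζ =
      Real.sqrt (α ^ 2 - ζ ^ 2) / Real.sqrt (η₂ ^ 2 - ζ ^ 2) *
        (ζ ^ 2 - ((η₂ ^ 2 - α ^ 2) / 2 + ξ / 3)))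
    (hzero : ∫ ζ in (0:ℝ)..α, h ζ = 0) :
    ∀ lam ∈ Set.Ioo 0 α, 0 < ∫ ζ in lam..α, h ζ := by
  intro lam hl
  obtain ⟨hl0, hlα⟩ := hl
  set ρ := (η₂ ^ 2 - α ^ 2) / 2 + ξ / 3 with hρ
  have hcont : ContinuousOn h (Set.Icc 0 α) := by
    have he : h = fun ζ => Real.sqrt (α ^ 2 - ζ ^ 2) / Real.sqrt (η₂ ^ 2 - ζ ^ 2) *
        (ζ ^ 2 - ρ) := funext hdef
    rw [he]
    refine ContinuousOn.mul (ContinuousOn.div (by fun_prop) (by fun_prop) ?_) (by fun_prop)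
    intro x hx
    have : 0 < η₂ ^ 2 - x ^ 2 := by nlinarith [hx.1, hx.2]
    exact (Real.sqrt_pos.mpr this).ne'
  have hi1 : IntervalIntegrable h volume 0 lam := by
    apply ContinuousOn.intervalIntegrable_of_Icc hl0.le
    exact hcont.mono (Set.Icc_subset_Icc le_rfl hlα.le)
  have hi2 : IntervalIntegrable h volume lam α := by
    apply ContinuousOn.intervalIntegrable_of_Icc hlα.le
    exact hcont.mono (Set.Icc_subset_Icc hl0.le le_rfl)
  have hw : ∀ x, 0 < x → x < α →
      0 < Real.sqrt (α ^ 2 - x ^ 2) / Real.sqrt (η₂ ^ 2 - x ^ 2) := by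
    intro x h0 h1
    have h2 : 0 < α ^ 2 - x ^ 2 := by nlinarith
    have h3 : 0 < η₂ ^ 2 - x ^ 2 := by nlinarith
    exact div_pos (Real.sqrt_pos.mpr h2) (Real.sqrt_pos.mpr h3)
  rcases le_or_gt ρ (lam ^ 2) with hc | hc
  · apply intervalIntegral_pos_of_pos_on hi2 _ hlα
    intro x hx
    rw [hdef]
    have : 0 < x ^ 2 - ρ := by nlinarith [hx.1]
    exact mul_pos (hw x (hl0.trans hx.1) hx.2) this
  · have hneg : 0 < ∫ ζ in (0:ℝ)..lam, -h ζ := by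
      apply intervalIntegral_pos_of_pos_on hi1.neg _ hl0
      intro x hx
      have h1 : x ^ 2 - ρ < 0 := by nlinarith [hx.1, hx.2]
      have h2 := mul_neg_of_pos_of_neg (hw x hx.1 (hx.2.trans hlα)) h1
      have h3 := hdef x
      show 0 < -h x
      linarith
    rw [intervalIntegral.integral_neg] at hneg
    have hadd := intervalIntegral.integral_add_adjacent_intervals hi1 hi2
    linarith
end

section
/- Let 0 < η₁ < η₂ be real numbers, set m = η₁/η₂, c₁ = η₂²(E(m)/K(m) − 1), c₂ = η₁²η₂²/3 + (η₁² + η₂²)c₁/6, and define q(r, ξ) = 12(r² − (r/2)(η₁² + η₂²) + c₂) − 4ξ(r + c₁) for real r, ξ. Let ξ_crit = 3(η₁⁴ − (η₁²/2)(η₁² + η₂²) + c₂)/(η₁² + c₁). Then for every ξ < ξ_crit and every r ∈ [η₁², η₂²], one has q(r, ξ) > 0. -/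
open MeasureTheory intervalIntegral

lemma delta_pos {k : ℝ} (hk0 : 0 < k) (hk : k < 1) (θ : ℝ) :
    0 < 1 - k * Real.sin θ ^ 2 := by
  nlinarith [Real.sin_sq_le_one θ, sq_nonneg (Real.sin θ)]

lemma cont_inv {k : ℝ} (hk0 : 0 < k) (hk : k < 1) :
    Continuous fun θ : ℝ => 1 / Real.sqrt (1 - k * Real.sin θ ^ 2) := by
  refine Continuous.div (by fun_prop) (by fun_prop) ?_
  intro θ
  exact (Real.sqrt_pos.2 (delta_pos hk0 hk θ)).ne'

lemma K_pos {m : ℝ} (hk0 : 0 < m ^ 2) (hk : m ^ 2 < 1) : 0 < ellipticK m := by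
  unfold ellipticK
  apply intervalIntegral.intervalIntegral_pos_of_pos
  · exact (cont_inv hk0 hk).intervalIntegrable _ _
  · intro θ
    have := Real.sqrt_pos.2 (delta_pos hk0 hk θ)
    positivity
  · positivity

lemma E_lower {m : ℝ} (hk0 : 0 < m ^ 2) (hk : m ^ 2 < 1) :
    (1 - m ^ 2) * ellipticK m < ellipticE m := by
  unfold ellipticK ellipticE
  rw [← intervalIntegral.integral_const_mul]
  have hc := cont_inv hk0 hk
  apply intervalIntegral.integral_lt_integral_of_continuousOn_of_le_of_exists_lt
  · positivity
  · exact (hc.const_mul _).continuousOn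
  · fun_prop
  · intro θ _
    have h := delta_pos hk0 hk θ
    have hs := Real.sqrt_pos.2 h
    rw [mul_one_div, div_le_iff₀ hs, Real.mul_self_sqrt h.le]
    nlinarith [Real.sin_sq_le_one θ]
  · refine ⟨0, ⟨le_rfl, by positivity⟩, ?_⟩
    simp [hk0]

lemma E_upper {m : ℝ} (hk0 : 0 < m ^ 2) (hk : m ^ 2 < 1) :
    ellipticE m ≤ (1 - m ^ 2 / 2) * ellipticK m := by
  unfold ellipticK ellipticE
  set S := 1 / Real.sqrt (1 - m ^ 2 / 2) with hS
  have hc := cont_inv hk0 hk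
  have hI : ∫ θ in (0:ℝ)..(Real.pi / 2), m ^ 2 * S * (Real.sin θ ^ 2 - 1 / 2) = 0 := by
    rw [intervalIntegral.integral_const_mul, intervalIntegral.integral_sub
      (Continuous.intervalIntegrable (by fun_prop) _ _)
      (Continuous.intervalIntegrable (by fun_prop) _ _), integral_sin_sq]
    simp
    right
    ring
  have key : ∫ θ in (0:ℝ)..(Real.pi / 2), (Real.sqrt (1 - m ^ 2 * Real.sin θ ^ 2)
      + m ^ 2 * S * (Real.sin θ ^ 2 - 1 / 2)) ≤
      ∫ θ in (0:ℝ)..(Real.pi / 2),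
        (1 - m ^ 2 / 2) * (1 / Real.sqrt (1 - m ^ 2 * Real.sin θ ^ 2)) := by
    apply intervalIntegral.integral_mono_on (by positivity)
    · exact Continuous.intervalIntegrable (by fun_prop) _ _
    · exact (hc.const_mul _).intervalIntegrable _ _
    · intro θ _
      have h := delta_pos hk0 hk θ
      have hs := Real.sqrt_pos.2 h
      have h2 : 0 < 1 - m ^ 2 / 2 := by linarith
      have hs2 := Real.sqrt_pos.2 h2
      have e : Real.sqrt (1 - m ^ 2 * Real.sin θ ^ 2) =
          (1 - m ^ 2 * Real.sin θ ^ 2) * (1 / Real.sqrt (1 - m ^ 2 * Real.sin θ ^ 2)) := by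
        rw [mul_one_div, eq_div_iff hs.ne', Real.mul_self_sqrt h.le]
      have hp : 0 ≤ (Real.sin θ ^ 2 - 1 / 2) *
          (1 / Real.sqrt (1 - m ^ 2 * Real.sin θ ^ 2) - S) := by
        rcases le_total (Real.sin θ ^ 2) (1 / 2) with h3 | h3
        · apply mul_nonneg_of_nonpos_of_nonpos (by linarith)
          rw [sub_nonpos, hS]
          apply one_div_le_one_div_of_le hs2
          apply Real.sqrt_le_sqrt
          nlinarith
        · apply mul_nonneg (by linarith)
          rw [sub_nonneg, hS]
          apply one_div_le_one_div_of_le hs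
          apply Real.sqrt_le_sqrt
          nlinarith
      have hp2 := mul_nonneg hk0.le hp
      generalize 1 / Real.sqrt (1 - m ^ 2 * Real.sin θ ^ 2) = T at *
      rw [e]
      linarith
  rw [intervalIntegral.integral_add
      (Continuous.intervalIntegrable (by fun_prop) _ _)
      (Continuous.intervalIntegrable (by fun_prop) _ _), hI, add_zero,
      intervalIntegral.integral_const_mul] at key
  exact key

lemma poly_pos (a b c ξ r : ℝ) (ha : 0 < a) (hab : a < b) (h1 : 0 < a + c) (h2 : 2 * c ≤ -a)
    (hr : a ≤ r)
    (hξ : ξ * (a + c) < 3 * (a ^ 2 - a / 2 * (a + b) + (a * b / 3 + (a + b) * c / 6))) :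
    0 < 12 * (r ^ 2 - r / 2 * (a + b) + (a * b / 3 + (a + b) * c / 6)) - 4 * ξ * (r + c) := by
  have hrc : 0 < r + c := by linarith
  have k0 : 0 ≤ 3 * a ^ 2 - a * b + c * (4 * a - 2 * b) := by
    rcases le_total b (2 * a) with h | h
    · nlinarith [mul_nonneg h1.le (by linarith : 0 ≤ 4 * a - 2 * b), mul_pos ha (sub_pos.2 hab)]
    · nlinarith [mul_nonneg (by linarith : 0 ≤ -a - 2 * c) (by linarith : 0 ≤ b - 2 * a), sq_nonneg a]
  have k1 : 0 ≤ (r - a) * ((r - a) * (a + c) + (3 * a ^ 2 - a * b + c * (4 * a - 2 * b)) / 3) := by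
    have : 0 ≤ r - a := by linarith
    positivity
  have k2 := mul_lt_mul_of_pos_right hξ hrc
  refine pos_of_mul_pos_left (b := a + c) ?_ h1.le
  nlinarith

/-- sub-critical positivity of the quadratic polynomial q(r, ξ)
on [η₁², η₂²] for ξ < ξ_crit. -/
theorem subcritical_q_pos (η₁ η₂ : ℝ) (hη₁ : 0 < η₁) (hη : η₁ < η₂)
    (c₁ c₂ ξcrit : ℝ)
    (hc₁ : c₁ = η₂ ^ 2 * (ellipticE (η₁ / η₂) / ellipticK (η₁ / η₂) - 1))
    (hc₂ : c₂ = η₁ ^ 2 * η₂ ^ 2 / 3 + (η₁ ^ 2 + η₂ ^ 2) * c₁ / 6)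
    (q : ℝ → ℝ → ℝ)
    (hq : ∀ r ξ : ℝ, q r ξ =
      12 * (r ^ 2 - r / 2 * (η₁ ^ 2 + η₂ ^ 2) + c₂) - 4 * ξ * (r + c₁))
    (hξcrit : ξcrit =
      3 * (η₁ ^ 4 - η₁ ^ 2 / 2 * (η₁ ^ 2 + η₂ ^ 2) + c₂) / (η₁ ^ 2 + c₁)) :
    ∀ ξ < ξcrit, ∀ r ∈ Set.Icc (η₁ ^ 2) (η₂ ^ 2), 0 < q r ξ := by
  intro ξ hξ r hr
  have hη₂ : 0 < η₂ := hη₁.trans hη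
  have hb : 0 < η₂ ^ 2 := by positivity
  have ha : 0 < η₁ ^ 2 := by positivity
  have hab : η₁ ^ 2 < η₂ ^ 2 := by gcongr
  have hk0 : 0 < (η₁ / η₂) ^ 2 := by positivity
  have hk : (η₁ / η₂) ^ 2 < 1 := by rwa [div_pow, div_lt_one hb]
  have hm : η₂ ^ 2 * (η₁ / η₂) ^ 2 = η₁ ^ 2 := by field_simp
  have hK := K_pos hk0 hk
  have l := (lt_div_iff₀ hK).2 (E_lower hk0 hk)
  have u := (div_le_iff₀ hK).2 (E_upper hk0 hk)
  have l' := mul_lt_mul_of_pos_left l hb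
  have u' := mul_le_mul_of_nonneg_left u hb.le
  have h1 : 0 < η₁ ^ 2 + c₁ := by rw [hc₁]; linarith
  have h2 : 2 * c₁ ≤ -η₁ ^ 2 := by rw [hc₁]; linarith
  rw [hξcrit, lt_div_iff₀ h1, hc₂] at hξ
  rw [hq, hc₂]
  apply poly_pos _ _ _ _ _ ha hab h1 h2 hr.1
  linarith
end

section
/- Let 0 < η₁ < η₂ be real numbers and let g : [η₁, η₂] → ℂ be continuous and not identically zero. Then the double integral ∫_{η₁}^{η₂} ∫_{η₁}^{η₂} conj(g(λ)) · g(s) / (s + λ) ds dλ is a real number and is strictly positive. -/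
open MeasureTheory intervalIntegral Complex

lemma aux_moments (a b : ℝ) (hab : a < b) (f : ℝ → ℝ) (hf : Continuous f)
    (h : ∀ n : ℕ, ∫ s in a..b, Real.exp (-(s * ((n : ℝ) + 1))) * f s = 0) :
    ∀ x ∈ Set.Icc a b, f x = 0 := by
  have hp : ∀ p : Polynomial ℝ,
      ∫ s in a..b, Real.exp (-s) * p.eval (Real.exp (-s)) * f s = 0 := by
    intro p
    induction p using Polynomial.induction_on' with
    | add p q hp hq =>
      have : ∀ s : ℝ, Real.exp (-s) * (p + q).eval (Real.exp (-s)) * f s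
          = Real.exp (-s) * p.eval (Real.exp (-s)) * f s
            + Real.exp (-s) * q.eval (Real.exp (-s)) * f s := by
        intro s; rw [Polynomial.eval_add]; ring
      simp_rw [this]
      rw [intervalIntegral.integral_add, hp, hq, add_zero]
      · exact Continuous.intervalIntegrable (by fun_prop) _ _
      · exact Continuous.intervalIntegrable (by fun_prop) _ _
    | monomial n c =>
      have : ∀ s : ℝ, Real.exp (-s) * (Polynomial.monomial n c).eval (Real.exp (-s)) * f s
          = c * (Real.exp (-(s * ((n : ℝ) + 1))) * f s) := by
        intro s
        rw [Polynomial.eval_monomial, ← Real.exp_nat_mul,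
          show -(s * ((n : ℝ) + 1)) = -s + n * (-s) by ring, Real.exp_add]
        ring
      simp_rw [this]
      rw [intervalIntegral.integral_const_mul, h, mul_zero]
  by_contra hcon
  push Not at hcon
  obtain ⟨x, hx, hfx⟩ := hcon
  have hJ : 0 < ∫ s in a..b, Real.exp (-s) * f s * f s := by
    apply intervalIntegral.integral_pos hab (by fun_prop)
    · intro y _
      rw [mul_assoc]
      exact mul_nonneg (Real.exp_pos _).le (mul_self_nonneg _)
    · refine ⟨x, hx, ?_⟩
      rw [mul_assoc]
      exact mul_pos (Real.exp_pos _) (mul_self_pos.2 hfx)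
  set J := ∫ s in a..b, Real.exp (-s) * f s * f s with hJdef
  have hK : 0 ≤ ∫ s in a..b, Real.exp (-s) * |f s| :=
    intervalIntegral.integral_nonneg hab.le
      (fun s _ => mul_nonneg (Real.exp_pos _).le (abs_nonneg _))
  set K := ∫ s in a..b, Real.exp (-s) * |f s| with hKdef
  have hε : 0 < J / (K + 1) := by positivity
  obtain ⟨p, hpε⟩ := exists_polynomial_near_of_continuousOn (Real.exp (-b)) (Real.exp (-a))
    (fun u => f (-Real.log u))
    (by
      apply hf.comp_continuousOn
      apply ContinuousOn.neg
      apply Real.continuousOn_log.mono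
      intro u hu
      exact ((Real.exp_pos _).trans_le hu.1).ne') _ hε
  have h1 : J = ∫ s in a..b, (Real.exp (-s) * f s * f s
      - Real.exp (-s) * p.eval (Real.exp (-s)) * f s) := by
    rw [intervalIntegral.integral_sub, hp p, sub_zero]
    · exact Continuous.intervalIntegrable (by fun_prop) _ _
    · exact Continuous.intervalIntegrable (by fun_prop) _ _
  have h2 : J ≤ ∫ s in a..b, (J / (K + 1)) * (Real.exp (-s) * |f s|) := by
    rw [h1]
    apply intervalIntegral.integral_mono_on hab.le
    · exact Continuous.intervalIntegrable (by fun_prop) _ _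
    · exact Continuous.intervalIntegrable (by fun_prop) _ _
    · intro s hs
      have := hpε (Real.exp (-s)) ⟨Real.exp_le_exp.2 (by linarith [hs.2]),
        Real.exp_le_exp.2 (by linarith [hs.1])⟩
      simp only [Real.log_exp, neg_neg] at this
      rw [← h1]
      calc Real.exp (-s) * f s * f s - Real.exp (-s) * p.eval (Real.exp (-s)) * f s
          = Real.exp (-s) * ((f s - p.eval (Real.exp (-s))) * f s) := by ring
        _ ≤ Real.exp (-s) * (J / (K + 1) * |f s|) := by
            apply mul_le_mul_of_nonneg_left _ (Real.exp_pos _).le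
            refine (le_abs_self _).trans ?_
            rw [abs_mul, abs_sub_comm]
            exact mul_le_mul_of_nonneg_right this.le (abs_nonneg _)
        _ = _ := by ring
  rw [intervalIntegral.integral_const_mul, ← hKdef, div_mul_eq_mul_div,
    le_div_iff₀ (by positivity)] at h2
  nlinarith

lemma aux_main (a b : ℝ) (ha : 0 < a) (hab : a < b)
    (g : ℝ → ℂ) (hg : Continuous g) (C : ℝ) (hC : ∀ x, ‖g x‖ ≤ C)
    (hne : ∃ x ∈ Set.Icc a b, g x ≠ 0) :
    ∃ r : ℝ, 0 < r ∧ (∫ lam in a..b, ∫ s in a..b,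
        (starRingEnd ℂ) (g lam) * g s / ((s : ℂ) + (lam : ℂ))) = (r : ℂ) := by
  set μ : Measure ℝ := volume.restrict (Set.Ioc a b) with hμ
  set ν : Measure ℝ := volume.restrict (Set.Ioi (0:ℝ)) with hν
  let E : ℝ → ℝ → ℂ := fun x s => ((Real.exp (-(s * x)) : ℝ) : ℂ)
  let G : ℝ → ℂ := fun x => ∫ s in a..b, E x s * g s
  let F : (ℝ × ℝ) → ℝ → ℂ := fun p x =>
    (starRingEnd ℂ) (E x p.1 * g p.1) * (E x p.2 * g p.2)
  have hGc : Continuous G := by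
    apply intervalIntegral.continuous_parametric_intervalIntegral_of_continuous'
    simp only [E, Function.uncurry_def]
    fun_prop
  have hC0 : 0 ≤ C := (norm_nonneg _).trans (hC 0)
  have hFi : Integrable (Function.uncurry F) ((μ.prod μ).prod ν) := by
    have hb : Integrable (fun z : (ℝ × ℝ) × ℝ => (fun _ : ℝ × ℝ => C * C) z.1 *
        (fun x : ℝ => Real.exp (-(2 * a) * x)) z.2) ((μ.prod μ).prod ν) := by
      refine Integrable.mul_prod (f := fun _ : ℝ × ℝ => C * C)
        (g := fun x : ℝ => Real.exp (-(2 * a) * x)) ?_ ?_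
      · exact integrable_const _
      · exact exp_neg_integrableOn_Ioi 0 (by positivity)
    refine hb.mono' ?_ ?_
    · apply Continuous.aestronglyMeasurable
      simp only [F, E, Function.uncurry_def]
      have := Complex.continuous_conj
      fun_prop
    · rw [hμ, hν, Measure.prod_restrict, Measure.prod_restrict]
      refine ae_restrict_of_forall_mem
        ((measurableSet_Ioc.prod measurableSet_Ioc).prod measurableSet_Ioi) ?_
      rintro ⟨⟨l, s⟩, x⟩ ⟨⟨hl, hs⟩, hx⟩
      simp only [Set.mem_Ioc, Set.mem_Ioi] at hl hs hx
      simp only [Function.uncurry_apply_pair, F, E, norm_mul, RCLike.norm_conj,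
        Complex.norm_real, Real.norm_eq_abs, Real.abs_exp]
      have e : Real.exp (-(l * x)) * Real.exp (-(s * x)) ≤ Real.exp (-(2 * a) * x) := by
        rw [← Real.exp_add]
        apply Real.exp_le_exp.2
        nlinarith [mul_lt_mul_of_pos_right hl.1 hx, mul_lt_mul_of_pos_right hs.1 hx]
      calc Real.exp (-(l * x)) * ‖g l‖ * (Real.exp (-(s * x)) * ‖g s‖)
          = (‖g l‖ * ‖g s‖) * (Real.exp (-(l * x)) * Real.exp (-(s * x))) := by ring
        _ ≤ (C * C) * Real.exp (-(2 * a) * x) := by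
            gcongr
            · exact hC l
            · exact hC s
  have hFG : ∀ x, ∫ p, F p x ∂(μ.prod μ) = ((‖G x‖ ^ 2 : ℝ) : ℂ) := by
    intro x
    have := integral_prod_mul (μ := μ) (ν := μ)
      (fun l => (starRingEnd ℂ) (E x l * g l)) (fun s => E x s * g s)
    simp only [F]
    rw [this, integral_conj]
    simp only [G, intervalIntegral.integral_of_le hab.le]
    rw [Complex.conj_mul']
    push_cast
    rfl
  have hFs : ∀ p ∈ Set.Ioc a b ×ˢ Set.Ioc a b, ∫ x, F p x ∂ν
      = (starRingEnd ℂ) (g p.1) * g p.2 / ((p.2 : ℂ) + (p.1 : ℂ)) := by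
    rintro ⟨l, s⟩ ⟨hl, hs⟩
    simp only [Set.mem_Ioc] at hl hs
    have e : ∀ x : ℝ, F (l, s) x
        = ((starRingEnd ℂ) (g l) * g s) * Complex.exp (-((s : ℂ) + l) * x) := by
      intro x
      simp only [F, E, map_mul, Complex.conj_ofReal]
      rw [show -((s : ℂ) + l) * x = ((-(l * x) : ℝ) : ℂ) + ((-(s * x) : ℝ) : ℂ) by
        push_cast; ring, Complex.exp_add, Complex.ofReal_exp, Complex.ofReal_exp]
      ring
    simp_rw [e]
    rw [MeasureTheory.integral_const_mul, hν, integral_exp_mul_complex_Ioi]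
    · rw [neg_div_neg_eq, Complex.ofReal_zero, mul_zero, Complex.exp_zero, mul_one_div]
    · simp; linarith
  have hswap := integral_integral_swap hFi
  have hint2 := hFi.integral_prod_right
  simp only [Function.uncurry_apply_pair, hFG] at hint2
  simp_rw [hFG] at hswap
  have hGi : Integrable (fun x => ‖G x‖ ^ 2) ν := by
    exact hint2.re
  refine ⟨∫ x, ‖G x‖ ^ 2 ∂ν, ?_, ?_⟩
  · -- positivity
    obtain ⟨x₀, hx₀, hG0⟩ : ∃ x, 0 < x ∧ G x ≠ 0 := by
      by_contra hcon
      push Not at hcon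
      obtain ⟨y, hy, hgy⟩ := hne
      apply hgy
      have key : ∀ n : ℕ, ∫ s in a..b, E ((n : ℝ) + 1) s * g s = 0 :=
        fun n => hcon _ (by positivity)
      have hi : ∀ n : ℕ, IntervalIntegrable (fun s => E ((n : ℝ) + 1) s * g s) volume a b := by
        intro n
        apply Continuous.intervalIntegrable
        simp only [E]
        fun_prop
      apply Complex.ext
      · refine aux_moments a b hab (fun s => (g s).re) (by fun_prop) ?_ y hy
        intro n
        have := Complex.reCLM.intervalIntegral_comp_comm (hi n)
        rw [key n] at this
        simpa [E, -Complex.ofReal_exp] using this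
      · refine aux_moments a b hab (fun s => (g s).im) (by fun_prop) ?_ y hy
        intro n
        have := Complex.imCLM.intervalIntegral_comp_comm (hi n)
        rw [key n] at this
        simpa [E, -Complex.ofReal_exp] using this
    rw [hν, setIntegral_pos_iff_support_of_nonneg_ae
      (Filter.Eventually.of_forall fun x => by positivity) hGi]
    have ho : IsOpen (Function.support (fun x => ‖G x‖ ^ 2) ∩ Set.Ioi (0:ℝ)) :=
      (Continuous.isOpen_support (by fun_prop)).inter isOpen_Ioi
    refine ho.measure_pos _ ⟨x₀, ?_, hx₀⟩
    simpa using hG0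
  · rw [← integral_complex_ofReal, ← hswap]
    have hae : (fun p => ∫ x, F p x ∂ν) =ᵐ[μ.prod μ]
        fun p => (starRingEnd ℂ) (g p.1) * g p.2 / ((p.2 : ℂ) + (p.1 : ℂ)) := by
      rw [hμ, Measure.prod_restrict]
      exact ae_restrict_of_forall_mem (measurableSet_Ioc.prod measurableSet_Ioc) hFs
    have hint1 := hFi.integral_prod_left
    simp only [Function.uncurry_apply_pair] at hint1
    rw [integral_congr_ae hae, integral_prod _ (hint1.congr hae)]
    simp only [intervalIntegral.integral_of_le hab.le]
    rfl

/-- for continuous g not identically zero on [η₁, η₂] (η₁ > 0),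
the double integral ∫∫ conj(g(λ))g(s)/(s+λ) ds dλ is real and strictly positive. -/
theorem kernel_positive_definite (η₁ η₂ : ℝ) (hη₁ : 0 < η₁) (hη : η₁ < η₂)
    (g : ℝ → ℂ) (hg : ContinuousOn g (Set.Icc η₁ η₂))
    (hne : ∃ x ∈ Set.Icc η₁ η₂, g x ≠ 0) :
    (∫ lam in η₁..η₂, ∫ s in η₁..η₂,
        (starRingEnd ℂ) (g lam) * g s / ((s : ℂ) + (lam : ℂ))).im = 0 ∧
    0 < (∫ lam in η₁..η₂, ∫ s in η₁..η₂,
        (starRingEnd ℂ) (g lam) * g s / ((s : ℂ) + (lam : ℂ))).re := by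
  let g' : ℝ → ℂ := Set.IccExtend hη.le (fun x : Set.Icc η₁ η₂ => g x)
  have hg'c : Continuous g' :=
    Continuous.Icc_extend' (continuousOn_iff_continuous_domRestrict.1 hg)
  have hgg : ∀ x ∈ Set.Icc η₁ η₂, g' x = g x := fun x hx =>
    Set.IccExtend_of_mem hη.le _ hx
  obtain ⟨C, hC⟩ := isCompact_Icc.exists_bound_of_continuousOn hg
  have hC' : ∀ x, ‖g' x‖ ≤ C := fun x => hC _ (Set.projIcc η₁ η₂ hη.le x).2
  obtain ⟨y, hy, hgy⟩ := hne
  obtain ⟨r, hr, h⟩ := aux_main η₁ η₂ hη₁ hη g' hg'c C hC' ⟨y, hy, by rwa [hgg y hy]⟩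
  have heq : (∫ lam in η₁..η₂, ∫ s in η₁..η₂,
        (starRingEnd ℂ) (g lam) * g s / ((s : ℂ) + (lam : ℂ))) = (r : ℂ) := by
    rw [← h]
    apply intervalIntegral.integral_congr
    intro l hl
    apply intervalIntegral.integral_congr
    intro s hs
    rw [Set.uIcc_of_le hη.le] at hl hs
    simp only [hgg l hl, hgg s hs]
  rw [heq]
  exact ⟨Complex.ofReal_im r, by simpa using hr⟩
end

section
/- Let 0 < η₁ < η₂ be real numbers, let r : [η₁, η₂] → ℝ be continuous with r(λ) > 0 for all λ, and let f : [η₁, η₂] → ℂ be continuous. If f(λ) + (√(r(λ))/π) ∫_{η₁}^{η₂} √(r(s)) f(s)/(s + λ) ds = 0 for every λ ∈ [η₁, η₂], then f is identically zero. -/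
open MeasureTheory intervalIntegral Complex

lemma aux_pos (a b : ℝ) (ha : 0 < a) (h : ℝ → ℝ)
    (hh : Integrable h (volume.restrict (Set.Ioc a b))) :
    0 ≤ ∫ l in Set.Ioc a b, ∫ s in Set.Ioc a b, h l * h s / (s + l) := by
  set μ := (volume : Measure ℝ).restrict (Set.Ioc a b) with hμ
  set ν := (volume : Measure ℝ).restrict (Set.Ioi 0) with hν
  have hE : Integrable (fun t : ℝ => Real.exp (-(2 * a) * t)) ν :=
    integrableOn_exp_mul_Ioi (by linarith) 0
  have hhh : Integrable (fun p : ℝ × ℝ => h p.1 * h p.2) (μ.prod μ) := hh.mul_prod hh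
  have hdom : Integrable (fun x : (ℝ × ℝ) × ℝ => (h x.1.1 * h x.1.2) * Real.exp (-(2 * a) * x.2))
      ((μ.prod μ).prod ν) := hhh.mul_prod hE
  have hmem : ∀ᵐ x ∂((μ.prod μ).prod ν), x ∈ (Set.Ioc a b ×ˢ Set.Ioc a b) ×ˢ Set.Ioi (0 : ℝ) := by
    rw [hμ, hν, Measure.prod_restrict, Measure.prod_restrict]
    exact ae_restrict_mem ((measurableSet_Ioc.prod measurableSet_Ioc).prod measurableSet_Ioi)
  have hF : Integrable (fun x : (ℝ × ℝ) × ℝ =>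
      (h x.1.1 * h x.1.2) * Real.exp (-(x.1.1 + x.1.2) * x.2)) ((μ.prod μ).prod ν) := by
    refine hdom.mono ?_ ?_
    · refine (hhh.aestronglyMeasurable.comp_fst).mul ?_
      exact Continuous.aestronglyMeasurable (by fun_prop)
    · filter_upwards [hmem] with x hx
      obtain ⟨⟨h1, h2⟩, h3⟩ := hx
      rw [norm_mul, norm_mul (h x.1.1 * h x.1.2)]
      refine mul_le_mul_of_nonneg_left ?_ (norm_nonneg _)
      rw [Real.norm_of_nonneg (Real.exp_pos _).le, Real.norm_of_nonneg (Real.exp_pos _).le]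
      apply Real.exp_le_exp.mpr
      have h3' : 0 < x.2 := h3
      have := h1.1
      have := h2.1
      nlinarith
  have hmem2 : ∀ᵐ x ∂(μ.prod μ), x ∈ Set.Ioc a b ×ˢ Set.Ioc a b := by
    rw [hμ, Measure.prod_restrict]
    exact ae_restrict_mem (measurableSet_Ioc.prod measurableSet_Ioc)
  have hin : (fun p : ℝ × ℝ => ∫ t, (h p.1 * h p.2) * Real.exp (-(p.1 + p.2) * t) ∂ν)
      =ᵐ[μ.prod μ] fun p => h p.1 * h p.2 / (p.2 + p.1) := by
    filter_upwards [hmem2] with p hp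
    have h1 := hp.1.1
    have h2 := hp.2.1
    rw [MeasureTheory.integral_const_mul, hν, integral_exp_mul_Ioi (by linarith) 0]
    have : p.1 + p.2 ≠ 0 := by linarith
    have : p.2 + p.1 ≠ 0 := by linarith
    simp
    rw [← neg_add, neg_div_neg_eq, add_comm p.2]
    ring
  have hK : Integrable (fun p : ℝ × ℝ => h p.1 * h p.2 / (p.2 + p.1)) (μ.prod μ) :=
    hF.integral_prod_left.congr hin
  rw [← integral_prod (fun p : ℝ × ℝ => h p.1 * h p.2 / (p.2 + p.1)) hK, ← integral_congr_ae hin,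
    integral_integral_swap hF]
  refine integral_nonneg fun t => ?_
  have : (fun p : ℝ × ℝ => h p.1 * h p.2 * Real.exp (-(p.1 + p.2) * t)) =
      fun p => (h p.1 * Real.exp (-p.1 * t)) * (h p.2 * Real.exp (-p.2 * t)) := by
    funext p
    rw [show -(p.1 + p.2) * t = -p.1 * t + -p.2 * t by ring, Real.exp_add]
    ring
  simp only [this]
  rw [integral_prod_mul (fun x => h x * Real.exp (-x * t)) (fun x => h x * Real.exp (-x * t))]
  exact mul_self_nonneg _

lemma aux_real (a b : ℝ) (ha : 0 < a) (hab : a < b) (q g : ℝ → ℝ)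
    (hq : ContinuousOn q (Set.Icc a b)) (hg : ContinuousOn g (Set.Icc a b))
    (heq : ∀ l ∈ Set.Icc a b, g l + q l / Real.pi * ∫ s in a..b, q s * g s / (s + l) = 0) :
    ∀ l ∈ Set.Icc a b, g l = 0 := by
  have hh : Integrable (fun s => q s * g s) (volume.restrict (Set.Ioc a b)) :=
    ((hq.mul hg).integrableOn_Icc).mono_set Set.Ioc_subset_Icc_self
  have hpos := aux_pos a b ha _ hh
  by_contra! hne
  obtain ⟨c, hc, hc0⟩ := hne
  have hint : 0 < ∫ l in a..b, g l ^ 2 :=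
    intervalIntegral.integral_pos hab (hg.pow 2) (fun x _ => sq_nonneg _) ⟨c, hc, by positivity⟩
  have : ∫ l in a..b, g l ^ 2 = -(1 / Real.pi) *
      ∫ l in Set.Ioc a b, ∫ s in Set.Ioc a b, (q l * g l) * (q s * g s) / (s + l) := by
    rw [intervalIntegral.integral_of_le hab.le, ← MeasureTheory.integral_const_mul]
    refine setIntegral_congr_fun measurableSet_Ioc fun l hl => ?_
    have h1 := heq l (Set.Ioc_subset_Icc_self hl)
    rw [intervalIntegral.integral_of_le hab.le] at h1
    simp only [mul_div_assoc (q l * g l), MeasureTheory.integral_const_mul]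
    linear_combination (g l) * h1
  rw [this] at hint
  have : 0 < 1 / Real.pi := by positivity
  nlinarith

/-- the homogeneous integral equation
f(λ) + (√r(λ)/π)∫ √r(s) f(s)/(s+λ) ds = 0 on [η₁, η₂] (η₁ > 0, r > 0 continuous)
has only the trivial continuous solution. -/
theorem homogeneous_integral_equation_trivial
    (η₁ η₂ : ℝ) (hη₁ : 0 < η₁) (hη : η₁ < η₂)
    (r : ℝ → ℝ) (hr : ContinuousOn r (Set.Icc η₁ η₂))
    (hrpos : ∀ lam ∈ Set.Icc η₁ η₂, 0 < r lam)
    (f : ℝ → ℂ) (hf : ContinuousOn f (Set.Icc η₁ η₂))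
    (heq : ∀ lam ∈ Set.Icc η₁ η₂,
      f lam + ((Real.sqrt (r lam) / Real.pi : ℝ) : ℂ) *
        ∫ s in η₁..η₂, ((Real.sqrt (r s) : ℝ) : ℂ) * f s / ((s : ℂ) + (lam : ℂ)) = 0) :
    ∀ lam ∈ Set.Icc η₁ η₂, f lam = 0 := by
  have key : ∀ L : ℂ →L[ℝ] ℝ, ∀ l ∈ Set.Icc η₁ η₂, L (f l) = 0 := by
    intro L
    refine aux_real η₁ η₂ hη₁ hη (fun s => Real.sqrt (r s)) (fun s => L (f s)) hr.sqrt
      (L.continuous.comp_continuousOn hf) fun l hl => ?_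
    have h1 := heq l hl
    have h2 : (fun s : ℝ => ((Real.sqrt (r s) : ℝ) : ℂ) * f s / ((s : ℂ) + (l : ℂ))) =
        fun s : ℝ => (Real.sqrt (r s) / (s + l)) • f s := by
      funext s
      rw [Complex.real_smul]
      push_cast
      ring
    have hI : IntervalIntegrable (fun s : ℝ => (Real.sqrt (r s) / (s + l)) • f s)
        volume η₁ η₂ := by
      apply ContinuousOn.intervalIntegrable
      rw [Set.uIcc_of_le hη.le]
      refine ContinuousOn.smul (hr.sqrt.div (by fun_prop) fun s hs => ?_) hf
      have := hs.1
      have := hl.1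
      linarith
    rw [h2, ← Complex.real_smul] at h1
    have h3 := congrArg L h1
    rw [map_add, map_smul, ← L.intervalIntegral_comp_comm hI, map_zero] at h3
    simp only [map_smul, smul_eq_mul] at h3
    rw [← h3]
    congr 3
    funext s
    ring
  intro l hl
  exact Complex.ext (key reCLM l hl) (key imCLM l hl)
end

section
/- Let 0 < η₁ < η₂ be real numbers and let r : [η₁, η₂] → ℝ be continuous with r(λ) > 0 for all λ. Then there exists exactly one continuous function f : [η₁, η₂] → ℂ such that f(λ) + (√(r(λ))/π) ∫_{η₁}^{η₂} √(r(s)) f(s)/(s + λ) ds = −2 i r(λ) for every λ ∈ [η₁, η₂]. -/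
open MeasureTheory intervalIntegral Complex

noncomputable section

open BoundedContinuousFunction in
/-- integral operator with kernel `κ` against the functional `L` -/
def kernelOp {X : Type*} [TopologicalSpace X] [CompactSpace X]
    (κ : X → BoundedContinuousFunction X ℂ) (hκ : Continuous κ)
    (L : BoundedContinuousFunction X ℂ →L[ℂ] ℂ) :
    BoundedContinuousFunction X ℂ →ₗ[ℂ] BoundedContinuousFunction X ℂ where
  toFun f := mkOfCompact ⟨fun x => L (κ x * f), by fun_prop⟩
  map_add' f g := by ext x; simp [mul_add]
  map_smul' c f := by ext x; simp

theorem kernelOp_apply {X : Type*} [TopologicalSpace X] [CompactSpace X]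
    (κ : X → BoundedContinuousFunction X ℂ) (hκ : Continuous κ)
    (L : BoundedContinuousFunction X ℂ →L[ℂ] ℂ) (f : BoundedContinuousFunction X ℂ) (x : X) :
    kernelOp κ hκ L f x = L (κ x * f) := rfl

theorem kernelOp_compact {X : Type*} [TopologicalSpace X] [CompactSpace X]
    (κ : X → BoundedContinuousFunction X ℂ) (hκ : Continuous κ)
    (L : BoundedContinuousFunction X ℂ →L[ℂ] ℂ) :
    IsCompactOperator (kernelOp κ hκ L) := by
  rw [isCompactOperator_iff_isCompact_closure_image_closedBall _ zero_lt_one]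
  obtain ⟨C, hC⟩ := isCompact_univ.exists_bound_of_continuousOn hκ.continuousOn
  have key : ∀ (a f : BoundedContinuousFunction X ℂ), ‖f‖ ≤ 1 → ‖L (a * f)‖ ≤ ‖L‖ * ‖a‖ := by
    intro a f hf
    calc ‖L (a * f)‖ ≤ ‖L‖ * ‖a * f‖ := L.le_opNorm _
      _ ≤ ‖L‖ * (‖a‖ * ‖f‖) := by gcongr; exact norm_mul_le _ _
      _ ≤ ‖L‖ * (‖a‖ * 1) := by gcongr
      _ = _ := by ring
  refine BoundedContinuousFunction.arzela_ascoli (Metric.closedBall 0 (‖L‖ * C))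
    (isCompact_closedBall _ _) _ ?_ ?_
  · rintro _ x ⟨f, hf, rfl⟩
    rw [mem_closedBall_zero_iff] at hf ⊢
    rw [kernelOp_apply]
    refine (key _ _ hf).trans ?_
    gcongr
    exact hC x trivial
  · intro x
    rw [Metric.equicontinuousAt_iff_right]
    intro ε hε
    have h1 : Filter.Tendsto (fun y => ‖L‖ * ‖κ x - κ y‖) (nhds x) (nhds 0) := by
      have : Continuous (fun y => ‖L‖ * ‖κ x - κ y‖) := by fun_prop
      simpa using this.tendsto x
    filter_upwards [h1.eventually (gt_mem_nhds hε)] with y hy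
    rintro ⟨_, f, hf, rfl⟩
    rw [mem_closedBall_zero_iff] at hf
    refine lt_of_le_of_lt ?_ hy
    rw [dist_eq_norm]
    simp only [kernelOp_apply]
    rw [← map_sub, ← sub_mul]
    exact key _ _ hf

theorem kernelOp_surj {X : Type*} [TopologicalSpace X] [CompactSpace X]
    (κ : X → BoundedContinuousFunction X ℂ) (hκ : Continuous κ)
    (L : BoundedContinuousFunction X ℂ →L[ℂ] ℂ)
    (hinj : ∀ f : BoundedContinuousFunction X ℂ, (∀ x, f x + L (κ x * f) = 0) → f = 0)
    (b : BoundedContinuousFunction X ℂ) :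
    ∃ f : BoundedContinuousFunction X ℂ, ∀ x, f x + L (κ x * f) = b x := by
  have hc := kernelOp_compact κ hκ L
  let T := ContinuousLinearMap.mkOfIsCompactOperator hc
  have hT : IsCompactOperator T := hc
  rcases hT.hasEigenvalue_or_mem_resolventSet (μ := (-1 : ℂ)) (by norm_num) with h | h
  · exfalso
    obtain ⟨f, hf⟩ := h.exists_hasEigenvector
    refine hf.2 (hinj f fun x => ?_)
    have h2 : T f = (-1 : ℂ) • f := hf.apply_eq_smul
    have h3 := congrArg (fun g : BoundedContinuousFunction X ℂ => g x) h2
    have h4 : T f x = L (κ x * f) := rfl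
    simp only [h4] at h3
    rw [h3]; simp
  · rw [spectrum.mem_resolventSet_iff, ContinuousLinearMap.isUnit_iff_bijective] at h
    obtain ⟨f, hf⟩ := h.2 (-b)
    refine ⟨f, fun x => ?_⟩
    have h3 := congrArg (fun g : BoundedContinuousFunction X ℂ => g x) hf
    have h4 : T f x = L (κ x * f) := rfl
    simp [h4, Algebra.algebraMap_eq_smul_one] at h3
    linear_combination -h3

theorem expMem (s : ℝ) (hs : 0 < s) : MemLp (fun x : ℝ => ((Real.exp (-s * x) : ℝ) : ℂ)) 2
    (volume.restrict (Set.Ioi 0)) := by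
  rw [memLp_two_iff_integrable_sq_norm (by fun_prop)]
  have := integrableOn_exp_mul_Ioi (a := -(2 * s)) (by linarith) 0
  refine this.congr (.of_forall fun x => ?_)
  simp only [Complex.norm_real, Real.norm_eq_abs, sq_abs]
  rw [← Real.exp_nat_mul]; congr 1; push_cast; ring

def expVec (s : ℝ) : Lp ℂ 2 (volume.restrict (Set.Ioi (0 : ℝ))) :=
  if hs : 0 < s then (expMem s hs).toLp _ else 0

theorem expVec_inner (s t : ℝ) (hs : 0 < s) (ht : 0 < t) :
    inner ℂ (expVec s) (expVec t) = (((s + t)⁻¹ : ℝ) : ℂ) := by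
  rw [expVec, expVec, dif_pos hs, dif_pos ht, L2.inner_def]
  have h := integral_exp_mul_Ioi (a := -(s + t)) (by linarith) 0
  have h2 : (((s + t)⁻¹ : ℝ)) = ∫ x in Set.Ioi (0:ℝ), Real.exp (-(s + t) * x) := by
    rw [h, mul_zero, Real.exp_zero, neg_div_neg_eq, one_div]
  rw [h2, ← integral_complex_ofReal]
  apply MeasureTheory.integral_congr_ae
  filter_upwards [(expMem s hs).coeFn_toLp, (expMem t ht).coeFn_toLp] with x h1 h2
  rw [h1, h2]
  simp only [RCLike.inner_apply, Complex.conj_ofReal]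
  rw [← Complex.ofReal_mul, ← Real.exp_add]
  congr 2; ring

theorem expVec_cont : ContinuousOn expVec (Set.Ioi 0) := by
  intro s hs
  rw [ContinuousWithinAt, tendsto_iff_norm_sub_tendsto_zero]
  have hs' : (0:ℝ) < s := hs
  have h1 : ContinuousAt (fun t : ℝ => Real.sqrt ((t + t)⁻¹ - 2 * (t + s)⁻¹ + (s + s)⁻¹)) s := by
    have : s + s ≠ 0 := by positivity
    fun_prop (disch := assumption)
  have h2 := h1.tendsto.mono_left (nhdsWithin_le_nhds (s := Set.Ioi 0))
  have h0 : Real.sqrt ((s + s)⁻¹ - 2 * (s + s)⁻¹ + (s + s)⁻¹) = 0 := by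
    rw [Real.sqrt_eq_zero']; linarith
  rw [h0] at h2
  refine h2.congr' ?_
  filter_upwards [self_mem_nhdsWithin] with t ht
  have ht' : (0:ℝ) < t := ht
  have hn : ∀ u : ℝ, 0 < u → ‖expVec u‖ ^ 2 = (u + u)⁻¹ := by
    intro u hu
    rw [← inner_self_eq_norm_sq (𝕜 := ℂ), expVec_inner u u hu hu]
    exact Complex.ofReal_re _
  rw [← Real.sqrt_sq (norm_nonneg (expVec t - expVec s)), norm_sub_sq (𝕜 := ℂ),
    expVec_inner t s ht' hs', hn t ht', hn s hs']
  congr 3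

theorem uniq_aux (η₁ η₂ : ℝ) (hη₁ : 0 < η₁) (hη : η₁ < η₂)
    (r : ℝ → ℝ) (hr : ContinuousOn r (Set.Icc η₁ η₂))
    (h : ℝ → ℂ) (hh : ContinuousOn h (Set.Icc η₁ η₂))
    (heq : ∀ lam ∈ Set.Icc η₁ η₂,
          h lam + ((Real.sqrt (r lam) / Real.pi : ℝ) : ℂ) *
              ∫ s in η₁..η₂, ((Real.sqrt (r s) : ℝ) : ℂ) * h s / ((s : ℂ) + (lam : ℂ)) = 0) :
    ∀ lam ∈ Set.Icc η₁ η₂, h lam = 0 := by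
  have hsub : Set.Icc η₁ η₂ ⊆ Set.Ioi 0 := fun x hx => lt_of_lt_of_le hη₁ hx.1
  have hec : ContinuousOn expVec (Set.Icc η₁ η₂) := expVec_cont.mono hsub
  have hG : ContinuousOn (fun s => (((Real.sqrt (r s) : ℝ) : ℂ) * h s) • expVec s)
      (Set.Icc η₁ η₂) := by
    fun_prop
  have hGi : Integrable (fun s => (((Real.sqrt (r s) : ℝ) : ℂ) * h s) • expVec s)
      (volume.restrict (Set.Ioc η₁ η₂)) :=
    (hG.integrableOn_Icc).mono_set Set.Ioc_subset_Icc_self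
  set v := ∫ s in Set.Ioc η₁ η₂, (((Real.sqrt (r s) : ℝ) : ℂ) * h s) • expVec s with hv
  have h1 : ∀ lam ∈ Set.Icc η₁ η₂, inner ℂ (expVec lam) v =
      ∫ s in η₁..η₂, ((Real.sqrt (r s) : ℝ) : ℂ) * h s / ((s : ℂ) + (lam : ℂ)) := by
    intro lam hlam
    rw [hv, ← integral_inner hGi, intervalIntegral.integral_of_le hη.le]
    refine setIntegral_congr_fun measurableSet_Ioc fun s hs => ?_
    rw [inner_smul_right, expVec_inner lam s (hsub hlam) (hsub (Set.Ioc_subset_Icc_self hs))]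
    push_cast
    rw [add_comm, div_eq_mul_inv]
  have h2 : inner ℂ v v = ∫ s in Set.Ioc η₁ η₂, ((-(Real.pi * ‖h s‖ ^ 2) : ℝ) : ℂ) := by
    have h3 := integral_inner (𝕜 := ℂ) hGi v
    rw [← hv] at h3
    rw [← inner_conj_symm, ← h3, ← integral_conj]
    refine setIntegral_congr_fun measurableSet_Ioc fun s hs => ?_
    have hs' := Set.Ioc_subset_Icc_self hs
    rw [inner_conj_symm, inner_smul_left, h1 s hs']
    have h3 := heq s hs'
    have hpi : (Real.pi : ℂ) ≠ 0 := by exact_mod_cast Real.pi_ne_zero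
    set J := ∫ t in η₁..η₂, ((Real.sqrt (r t) : ℝ) : ℂ) * h t / ((t : ℂ) + (s : ℂ))
    have h4 : ((Real.sqrt (r s) : ℝ) : ℂ) * J = - Real.pi * h s := by
      push_cast at h3
      field_simp at h3
      linear_combination h3
    rw [map_mul, Complex.conj_ofReal]
    push_cast
    have h5 := Complex.conj_mul' (h s)
    linear_combination (starRingEnd ℂ (h s)) * h4 - Real.pi * h5
  intro lam hlam
  by_contra hne
  have h6 : 0 < ∫ s in η₁..η₂, Real.pi * ‖h s‖ ^ 2 := by
    refine intervalIntegral.integral_pos hη (by fun_prop) (fun x _ => by positivity)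
      ⟨lam, hlam, by positivity⟩
  rw [intervalIntegral.integral_of_le hη.le] at h6
  rw [integral_complex_ofReal, MeasureTheory.integral_neg] at h2
  have h7 := congrArg Complex.re h2
  rw [Complex.ofReal_re] at h7
  have h8 : 0 ≤ (inner ℂ v v).re := inner_self_nonneg (𝕜 := ℂ)
  linarith

def intFun (a b : ℝ) (hab : a ≤ b) : BoundedContinuousFunction (Set.Icc a b) ℂ →L[ℂ] ℂ :=
  LinearMap.mkContinuous
    { toFun := fun f => ∫ s in a..b, f (Set.projIcc a b hab s)
      map_add' := fun f g => by
        simp only [BoundedContinuousFunction.coe_add, Pi.add_apply]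
        refine intervalIntegral.integral_add ?_ ?_
        · exact (f.continuous.comp continuous_projIcc).intervalIntegrable _ _
        · exact (g.continuous.comp continuous_projIcc).intervalIntegrable _ _
      map_smul' := fun c f => by
        simp }
    |b - a| (fun f => by
      have := intervalIntegral.norm_integral_le_of_norm_le_const (a := a) (b := b) (C := ‖f‖)
        (f := fun s => f (Set.projIcc a b hab s)) (fun x _ => f.norm_coe_le_norm _)
      rw [mul_comm]
      exact this)

theorem intFun_apply (a b : ℝ) (hab : a ≤ b) (f : BoundedContinuousFunction (Set.Icc a b) ℂ) :
    intFun a b hab f = ∫ s in a..b, f (Set.projIcc a b hab s) := rfl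

end

/-- unique solvability of the integral equation
f(λ) + (√r(λ)/π)∫ √r(s) f(s)/(s+λ) ds = −2ir(λ) on [η₁, η₂]:
there exists a continuous solution, and any two continuous solutions
agree on [η₁, η₂]. -/
theorem integral_equation_exists_unique
    (η₁ η₂ : ℝ) (hη₁ : 0 < η₁) (hη : η₁ < η₂)
    (r : ℝ → ℝ) (hr : ContinuousOn r (Set.Icc η₁ η₂))
    (hrpos : ∀ lam ∈ Set.Icc η₁ η₂, 0 < r lam) :
    ∃ f : ℝ → ℂ,
      (ContinuousOn f (Set.Icc η₁ η₂) ∧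
        ∀ lam ∈ Set.Icc η₁ η₂,
          f lam + ((Real.sqrt (r lam) / Real.pi : ℝ) : ℂ) *
              ∫ s in η₁..η₂, ((Real.sqrt (r s) : ℝ) : ℂ) * f s / ((s : ℂ) + (lam : ℂ)) =
            -2 * Complex.I * (r lam : ℂ)) ∧
      ∀ f' : ℝ → ℂ,
        (ContinuousOn f' (Set.Icc η₁ η₂) ∧
          ∀ lam ∈ Set.Icc η₁ η₂,
            f' lam + ((Real.sqrt (r lam) / Real.pi : ℝ) : ℂ) *
                ∫ s in η₁..η₂, ((Real.sqrt (r s) : ℝ) : ℂ) * f' s / ((s : ℂ) + (lam : ℂ)) =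
              -2 * Complex.I * (r lam : ℂ)) →
        Set.EqOn f f' (Set.Icc η₁ η₂) := by
  classical
  let X := Set.Icc η₁ η₂
  have hpos : ∀ x : X, 0 < (x : ℝ) := fun x => lt_of_lt_of_le hη₁ x.2.1
  have hrX : Continuous (fun x : X => r x) := continuousOn_iff_continuous_domRestrict.1 hr
  let K : C(X × X, ℂ) := ⟨fun p => ((Real.sqrt (r p.1) / Real.pi : ℝ) : ℂ) *
    (((Real.sqrt (r p.2) : ℝ) : ℂ) / (((p.2 : ℝ) : ℂ) + ((p.1 : ℝ) : ℂ))), by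
      have h1 : Continuous (fun p : X × X => r p.1) := hrX.comp continuous_fst
      have h2 : Continuous (fun p : X × X => r p.2) := hrX.comp continuous_snd
      have h3 : ∀ p : X × X, (((p.2 : ℝ) : ℂ) + ((p.1 : ℝ) : ℂ)) ≠ 0 := by
        intro p
        have := add_pos (hpos p.2) (hpos p.1)
        exact_mod_cast this.ne'
      refine Continuous.mul (Complex.continuous_ofReal.comp (h1.sqrt.div_const _))
        (Continuous.div (Complex.continuous_ofReal.comp h2.sqrt) (by fun_prop) h3)⟩
  let κ : X → BoundedContinuousFunction X ℂ :=
    fun x => ContinuousMap.isometryEquivBoundedOfCompact X ℂ (K.curry x)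
  have hκ : Continuous κ :=
    (ContinuousMap.isometryEquivBoundedOfCompact X ℂ).continuous.comp K.curry.continuous
  let L := intFun η₁ η₂ hη.le
  have hL : ∀ (g : BoundedContinuousFunction X ℂ) (F : ℝ → ℂ), (∀ x : X, F x = g x) →
      ∀ x : X, L (κ x * g) = ((Real.sqrt (r x) / Real.pi : ℝ) : ℂ) *
        ∫ s in η₁..η₂, ((Real.sqrt (r s) : ℝ) : ℂ) * F s / ((s : ℂ) + ((x : ℝ) : ℂ)) := by
    intro g F hF x
    rw [intFun_apply, ← intervalIntegral.integral_const_mul]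
    refine intervalIntegral.integral_congr fun s hs => ?_
    rw [Set.uIcc_of_le hη.le] at hs
    have h1 : κ x ⟨s, hs⟩ = ((Real.sqrt (r x) / Real.pi : ℝ) : ℂ) *
      (((Real.sqrt (r s) : ℝ) : ℂ) / ((s : ℂ) + ((x : ℝ) : ℂ))) := rfl
    have h2 := hF ⟨s, hs⟩
    simp only [Set.projIcc_of_mem hη.le hs, BoundedContinuousFunction.coe_mul, Pi.mul_apply]
    rw [h1, ← h2]
    ring
  have hext : ∀ (g : BoundedContinuousFunction X ℂ) (x : X),
      Set.IccExtend hη.le g x = g x := fun g x => Set.IccExtend_val hη.le g x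
  have hextc : ∀ (g : BoundedContinuousFunction X ℂ), Continuous (Set.IccExtend hη.le g) :=
    fun g => g.continuous.Icc_extend'
  have hinj : ∀ f : BoundedContinuousFunction X ℂ, (∀ x, f x + L (κ x * f) = 0) → f = 0 := by
    intro f hf
    have h0 := uniq_aux η₁ η₂ hη₁ hη r hr (Set.IccExtend hη.le f) (hextc f).continuousOn (by
      intro lam hlam
      have h1 := hf ⟨lam, hlam⟩
      rw [hL f _ (hext f) ⟨lam, hlam⟩, ← hext f] at h1
      exact h1)
    ext x
    rw [← hext f x]
    exact h0 x x.2
  let b : BoundedContinuousFunction X ℂ := BoundedContinuousFunction.mkOfCompact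
    ⟨fun x => -2 * Complex.I * (r x : ℂ), continuous_const.mul (Complex.continuous_ofReal.comp hrX)⟩
  obtain ⟨f, hf⟩ := kernelOp_surj κ hκ L hinj b
  have hfeq : ∀ lam ∈ Set.Icc η₁ η₂,
      Set.IccExtend hη.le f lam + ((Real.sqrt (r lam) / Real.pi : ℝ) : ℂ) *
        ∫ s in η₁..η₂, ((Real.sqrt (r s) : ℝ) : ℂ) * Set.IccExtend hη.le f s /
          ((s : ℂ) + (lam : ℂ)) = -2 * Complex.I * (r lam : ℂ) := by
    intro lam hlam
    have h1 := hf ⟨lam, hlam⟩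
    rw [hL f _ (hext f) ⟨lam, hlam⟩, ← hext f] at h1
    exact h1
  refine ⟨Set.IccExtend hη.le f, ⟨(hextc f).continuousOn, hfeq⟩, ?_⟩
  rintro f' ⟨hf'c, hf'⟩ lam hlam
  have hint : ∀ F : ℝ → ℂ, ContinuousOn F (Set.Icc η₁ η₂) → ∀ x ∈ Set.Icc η₁ η₂,
      IntervalIntegrable (fun s => ((Real.sqrt (r s) : ℝ) : ℂ) * F s / ((s : ℂ) + (x : ℂ)))
        volume η₁ η₂ := by
    intro F hF x hx
    apply ContinuousOn.intervalIntegrable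
    rw [Set.uIcc_of_le hη.le]
    refine ContinuousOn.div (by fun_prop) (by fun_prop) fun s hs => ?_
    have := add_pos (hpos ⟨s, hs⟩) (hpos ⟨x, hx⟩)
    exact_mod_cast this.ne'
  have h0 := uniq_aux η₁ η₂ hη₁ hη r hr (fun s => Set.IccExtend hη.le f s - f' s)
    ((hextc f).continuousOn.sub hf'c) (by
      intro x hx
      have h1 := hfeq x hx
      have h2 := hf' x hx
      simp only [mul_sub, sub_div]
      rw [intervalIntegral.integral_sub (hint _ (hextc f).continuousOn x hx) (hint _ hf'c x hx)]
      linear_combination h1 - h2) lam hlam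
  exact sub_eq_zero.1 h0
end

section
/- Let η₂ > 0 and for 0 < α < η₂ set m_α = α/η₂ and F(α) = (α² + η₂²)/2 + α²(α² − η₂²)/(α² − η₂² + η₂²·E(m_α)/K(m_α)). Then F(α) → −3η₂²/2 as α → 0⁺. -/
open MeasureTheory intervalIntegral Filter

lemma aux_pos_s17 (m : ℝ) (hm : |m| < 1 / 2) (θ : ℝ) :
    1 / 4 ≤ 1 - m ^ 2 * Real.sin θ ^ 2 := by
  have h1 : m ^ 2 ≤ 1 / 4 := by
    have := abs_lt.1 hm
    nlinarith
  have h2 := Real.sin_sq_le_one θ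
  nlinarith [sq_nonneg m, sq_nonneg (Real.sin θ)]

lemma aux_cont (m : ℝ) (hm : |m| < 1 / 2) (g : ℝ → ℝ) (hg : Continuous g) :
    Continuous fun θ => g θ / Real.sqrt (1 - m ^ 2 * Real.sin θ ^ 2) := by
  refine hg.div (by fun_prop) fun θ => ?_
  have := aux_pos_s17 m hm θ
  exact (Real.sqrt_pos.2 (by linarith)).ne'

lemma aux_ev : ∀ᶠ m : ℝ in nhds 0, |m| < 1 / 2 := by
  have : Tendsto (fun m : ℝ => |m|) (nhds 0) (nhds |0|) := continuous_abs.tendsto 0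
  rw [abs_zero] at this
  exact this.eventually (gt_mem_nhds (by norm_num))

lemma aux_lim (g : ℝ → ℝ) (hg : Continuous g) (hb : ∀ θ, |g θ| ≤ 1) :
    ContinuousAt (fun m : ℝ => ∫ θ in (0:ℝ)..(Real.pi / 2),
      g θ / Real.sqrt (1 - m ^ 2 * Real.sin θ ^ 2)) 0 := by
  apply intervalIntegral.continuousAt_of_dominated_interval (bound := fun _ => 2)
  · filter_upwards [aux_ev] with m hm
    exact (aux_cont m hm g hg).aestronglyMeasurable
  · filter_upwards [aux_ev] with m hm
    refine Eventually.of_forall fun θ _ => ?_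
    have h := aux_pos_s17 m hm θ
    have h2 : 1 / 2 ≤ Real.sqrt (1 - m ^ 2 * Real.sin θ ^ 2) :=
      Real.le_sqrt_of_sq_le (by linarith)
    rw [Real.norm_eq_abs, abs_div, abs_of_nonneg (Real.sqrt_nonneg _),
      div_le_iff₀ (by linarith)]
    linarith [hb θ]
  · exact intervalIntegrable_const
  · refine Eventually.of_forall fun θ _ => ?_
    refine ContinuousAt.div (by fun_prop) (by fun_prop) ?_
    simp

/-- the Whitham modulation velocity F(α) tends to −3η₂²/2
as α → 0⁺. -/
theorem whitham_velocity_trailing_edge (η₂ : ℝ) (hη₂ : 0 < η₂)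
    (F : ℝ → ℝ)
    (hF : ∀ α : ℝ, F α = (α ^ 2 + η₂ ^ 2) / 2 +
      α ^ 2 * (α ^ 2 - η₂ ^ 2) /
        (α ^ 2 - η₂ ^ 2 + η₂ ^ 2 * (ellipticE (α / η₂) / ellipticK (α / η₂)))) :
    Tendsto F (nhdsWithin 0 (Set.Ioi 0)) (nhds (-3 * η₂ ^ 2 / 2)) := by
  set D : ℝ → ℝ := fun m => ∫ θ in (0:ℝ)..(Real.pi / 2),
      Real.sin θ ^ 2 / Real.sqrt (1 - m ^ 2 * Real.sin θ ^ 2) with hD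
  have hDc : ContinuousAt D 0 := aux_lim (fun θ => Real.sin θ ^ 2) (by fun_prop) fun θ => by
    rw [abs_of_nonneg (sq_nonneg _)]; exact Real.sin_sq_le_one θ
  have hKc : ContinuousAt ellipticK 0 := aux_lim (fun _ => 1) (by fun_prop) fun θ => by simp
  have hK0 : ellipticK 0 = Real.pi / 2 := by simp [ellipticK]
  have hD0 : D 0 = Real.pi / 4 := by
    simp [hD, integral_sin_sq]
    ring
  have hE : ∀ m : ℝ, |m| < 1 / 2 → ellipticE m = ellipticK m - m ^ 2 * D m := by
    intro m hm
    rw [hD, ellipticE, ellipticK]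
    simp only
    rw [← intervalIntegral.integral_const_mul, ← intervalIntegral.integral_sub]
    · refine intervalIntegral.integral_congr fun θ _ => ?_
      have h := aux_pos_s17 m hm θ
      have h2 := Real.sqrt_pos.2 (show 0 < 1 - m ^ 2 * Real.sin θ ^ 2 by linarith)
      have h3 := Real.sq_sqrt (show 0 ≤ 1 - m ^ 2 * Real.sin θ ^ 2 by linarith)
      beta_reduce
      rw [← mul_div_assoc, ← sub_div, eq_div_iff h2.ne', ← sq, h3]
    · exact (aux_cont m hm (fun _ => 1) (by fun_prop)).intervalIntegrable _ _
    · exact ((aux_cont m hm (fun θ => Real.sin θ ^ 2) (by fun_prop)).const_mul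
        (m ^ 2)).intervalIntegrable _ _
  have hpi := Real.pi_pos
  have hdiv : Tendsto (fun α : ℝ => α / η₂) (nhds 0) (nhds 0) := by
    have : Continuous fun α : ℝ => α / η₂ := by fun_prop
    simpa using this.tendsto 0
  have hKt : Tendsto (fun α => ellipticK (α / η₂)) (nhds 0) (nhds (Real.pi / 2)) := by
    rw [← hK0]; exact hKc.tendsto.comp hdiv
  have hDt : Tendsto (fun α => D (α / η₂)) (nhds 0) (nhds (Real.pi / 4)) := by
    rw [← hD0]; exact hDc.tendsto.comp hdiv
  have hden : Tendsto (fun α => 1 - D (α / η₂) / ellipticK (α / η₂)) (nhds 0)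
      (nhds (1 / 2)) := by
    have := (hDt.div hKt (by positivity)).const_sub 1
    have e : (1:ℝ) / 2 = 1 - Real.pi / 4 / (Real.pi / 2) := by
      field_simp
      norm_num
    rw [e]
    exact this
  have hG : Tendsto (fun α => (α ^ 2 + η₂ ^ 2) / 2 + (α ^ 2 - η₂ ^ 2) /
      (1 - D (α / η₂) / ellipticK (α / η₂))) (nhds 0) (nhds (-3 * η₂ ^ 2 / 2)) := by
    have h1 : Tendsto (fun α : ℝ => (α ^ 2 + η₂ ^ 2) / 2) (nhds 0)
        (nhds ((0 ^ 2 + η₂ ^ 2) / 2)) :=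
      Continuous.tendsto (by fun_prop) 0
    have h2 : Tendsto (fun α : ℝ => α ^ 2 - η₂ ^ 2) (nhds 0) (nhds (0 ^ 2 - η₂ ^ 2)) :=
      Continuous.tendsto (by fun_prop) 0
    have e : -3 * η₂ ^ 2 / 2 = (0 ^ 2 + η₂ ^ 2) / 2 + (0 ^ 2 - η₂ ^ 2) / (1 / 2) := by ring
    rw [e]
    exact h1.add (h2.div hden (by norm_num))
  refine (hG.mono_left nhdsWithin_le_nhds).congr' ?_
  filter_upwards [self_mem_nhdsWithin,
    (hdiv.eventually aux_ev).filter_mono nhdsWithin_le_nhds,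
    (hKt.eventually (lt_mem_nhds (show (0:ℝ) < Real.pi / 2 by positivity))).filter_mono
      nhdsWithin_le_nhds] with α hα hm hKp
  have hα0 : α ≠ 0 := ne_of_gt hα
  rw [hF, hE _ hm]
  have : α ^ 2 - η₂ ^ 2 + η₂ ^ 2 * ((ellipticK (α / η₂) - (α / η₂) ^ 2 * D (α / η₂)) /
      ellipticK (α / η₂)) = α ^ 2 * (1 - D (α / η₂) / ellipticK (α / η₂)) := by
    have hk := hKp.ne'
    generalize ellipticK (α / η₂) = k at *
    generalize D (α / η₂) = d at *
    field_simp
    ring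
  rw [this, mul_div_mul_left _ _ (pow_ne_zero 2 hα0)]
end
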